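/- Global convergence of the limit actor flow: assume the initial distribution satisfies μ(x) > 0 for all states x. Then for any optimal policy f*, J(f*) − J(f_{θ̄_t}) → 0 as t → ∞. -/

import Mathlib

open MeasureTheory Filter Set
open scoped Classical

noncomputable section

def softmaxPol {X A : Type*} [Fintype A] (θ : X → A → ℝ) (x : X) (a : A) : ℝ :=
  Real.exp (θ x a) / ∑ a', Real.exp (θ x a')

def explorePol {X A : Type*} [Fintype A] (η : ℝ) (θ : X → A → ℝ) (x : X) (a : A) : ℝ :=
  η / (Fintype.card A : ℝ) + (1 - η) * softmaxPol θ x a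

def zetaN (N k : ℕ) : ℝ := (1 + (k : ℝ) / (N : ℝ))⁻¹

def etaN (N k : ℕ) : ℝ := (1 + (Real.log ((k : ℝ) / (N : ℝ) + 1)) ^ 2)⁻¹

def zetaT (t : ℝ) : ℝ := (1 + t)⁻¹

def etaT (t : ℝ) : ℝ := (1 + (Real.log (t + 1)) ^ 2)⁻¹

def IsPolicy {X A : Type*} [Fintype A] (f : X → A → ℝ) : Prop :=
  (∀ x a, 0 ≤ f x a) ∧ ∀ x, ∑ a, f x a = 1

def ptilde {X A : Type*} (γ : ℝ) (p : X → A → X → ℝ) (μ : X → ℝ)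
    (x : X) (a : A) (x' : X) : ℝ :=
  γ * p x a x' + (1 - γ) * μ x'

def actorKer {X A : Type*} (γ : ℝ) (p : X → A → X → ℝ) (μ : X → ℝ) (f : X → A → ℝ) :
    X × A → X × A → ℝ :=
  fun ξ ξ' => ptilde γ p μ ξ.1 ξ.2 ξ'.1 * f ξ'.1 ξ'.2

def criticKer {X A : Type*} (p : X → A → X → ℝ) (g : X → A → ℝ) :
    X × A → X × A → ℝ :=
  fun ξ ξ' => p ξ.1 ξ.2 ξ'.1 * g ξ'.1 ξ'.2

def kpow {S : Type*} [Fintype S] [DecidableEq S] (K : S → S → ℝ) : ℕ → S → S → ℝ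
  | 0 => fun ξ ξ' => if ξ = ξ' then 1 else 0
  | n + 1 => fun ξ ξ' => ∑ y, K ξ y * kpow K n y ξ'

def IsStationaryDist {S : Type*} [Fintype S] (K : S → S → ℝ) (d : S → ℝ) : Prop :=
  (∀ ξ, 0 ≤ d ξ) ∧ (∑ ξ, d ξ = 1) ∧ ∀ ξ', d ξ' = ∑ ξ, d ξ * K ξ ξ'

def pathSum {X A : Type*} [Fintype X] [Fintype A] [DecidableEq X]
    (p : X → A → X → ℝ) : ℕ → X → A → X → ℝ
  | 0 => fun x _ x' => if x = x' then 1 else 0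
  | 1 => fun x a x' => p x a x'
  | n + 2 => fun x a x' => ∑ x₁ : X, ∑ a₁ : A, p x a x₁ * pathSum p (n + 1) x₁ a₁ x'

section Averaging

variable {ι : Type*} [Fintype ι]

lemma le_div_of_le_add_mul_average [Nonempty ι] {γ : ℝ} (hγ0 : 0 ≤ γ) (hγ1 : γ < 1)
    (P : (ι → ℝ) → ι → ℝ) (hP : ∀ D c, (∀ j, D j ≤ c) → ∀ i, P D i ≤ c)
    (D : ι → ℝ) (u : ℝ) (h : ∀ i, D i ≤ u + γ * P D i) (i : ι) : D i ≤ u / (1 - γ) := by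
  obtain ⟨m, hm⟩ := Finite.exists_max D
  have h1 := hP D (D m) hm m
  have h2 := h m
  have h3 : D m ≤ u / (1 - γ) := by
    rw [le_div_iff₀ (by linarith)]
    nlinarith
  exact (hm i).trans h3

lemma differentiableAt_of_mulVec_eq [DecidableEq ι] (M : ℝ → Matrix ι ι ℝ) (b : ι → ℝ)
    (v : ℝ → ι → ℝ) (t : ℝ) (hM : ∀ i j, DifferentiableAt ℝ (fun s => M s i j) t)
    (hdet : ∀ s, (M s).det ≠ 0) (hv : ∀ s, (M s).mulVec (v s) = b) (i : ι) :
    DifferentiableAt ℝ (fun s => v s i) t := by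
  have hdiff : ∀ N : ℝ → Matrix ι ι ℝ, (∀ i j, DifferentiableAt ℝ (fun s => N s i j) t) →
      DifferentiableAt ℝ (fun s => (N s).det) t := by
    intro N hN
    simp only [Matrix.det_apply]
    refine DifferentiableAt.fun_sum fun σ _ => ?_
    refine DifferentiableAt.const_smul ?_ _
    exact DifferentiableAt.fun_finsetProd fun k _ => hN _ _
  have heq : (fun s => v s i) =
      fun s => (∑ j, (M s).adjugate i j * b j) / (M s).det := by
    funext s
    rw [eq_div_iff (hdet s)]
    have h1 : (M s).adjugate.mulVec b = (M s).det • v s := by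
      rw [← hv s, Matrix.mulVec_mulVec, Matrix.adjugate_mul, Matrix.smul_mulVec,
        Matrix.one_mulVec]
    have h2 := congrFun h1 i
    simp only [Matrix.mulVec, dotProduct, Pi.smul_apply, smul_eq_mul] at h2
    rw [h2, mul_comm]
  rw [heq]
  refine DifferentiableAt.fun_div ?_ (hdiff M hM) (hdet t)
  refine DifferentiableAt.fun_sum fun j _ => ?_
  refine DifferentiableAt.mul_const ?_ _
  simp only [Matrix.adjugate_apply]
  refine hdiff _ fun k l => ?_
  by_cases hk : k = j
  · subst hk
    simp
  · simpa [Matrix.updateRow_apply, hk] using hM k l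

lemma IsStationaryDist.sum_mul_kpow [DecidableEq ι] {K : ι → ι → ℝ} {d : ι → ℝ}
    (h : IsStationaryDist K d) (n : ℕ) (j : ι) : ∑ i, d i * kpow K n i j = d j := by
  induction n with
  | zero => simp [kpow]
  | succ n ih =>
    simp only [kpow, Finset.mul_sum]
    rw [Finset.sum_comm]
    calc ∑ y, ∑ i, d i * (K i y * kpow K n y j)
        = ∑ y, (∑ i, d i * K i y) * kpow K n y j := by
          refine Finset.sum_congr rfl fun y _ => ?_
          rw [Finset.sum_mul]
          exact Finset.sum_congr rfl fun i _ => by ring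
      _ = ∑ y, d y * kpow K n y j :=
          Finset.sum_congr rfl fun y _ => by rw [← h.2.2 y]
      _ = d j := ih

lemma pow_mul_kpow_le_kpow [DecidableEq ι] {K K' : ι → ι → ℝ} {η : ℝ} (hη : 0 ≤ η)
    (hK : ∀ i j, 0 ≤ K i j) (h : ∀ i j, η * K i j ≤ K' i j) (n : ℕ) (i j : ι) :
    0 ≤ kpow K n i j ∧ η ^ n * kpow K n i j ≤ kpow K' n i j := by
  induction n generalizing i with
  | zero => by_cases hij : i = j <;> simp [kpow, hij]
  | succ n ih =>
    simp only [kpow, Finset.mul_sum]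
    refine ⟨Finset.sum_nonneg fun y _ => mul_nonneg (hK i y) (ih y).1,
      Finset.sum_le_sum fun y _ => ?_⟩
    calc η ^ (n + 1) * (K i y * kpow K n y j)
        = (η * K i y) * (η ^ n * kpow K n y j) := by ring
      _ ≤ K' i y * kpow K' n y j := by
          have h1 := (ih y).1
          have h2 := hK i y
          exact mul_le_mul (h i y) (ih y).2 (by positivity)
            ((mul_nonneg hη h2).trans (h i y))

lemma IsStationaryDist.sum_mul_le {K : ι → ι → ℝ} {d : ι → ℝ} (h : IsStationaryDist K d)
    (hK0 : ∀ i j, 0 ≤ K i j) (hK1 : ∀ i, ∑ j, K i j = 1) {γ : ℝ} (hγ : 0 ≤ γ) (D : ι → ℝ) :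
    ∑ i, D i * (d i * (γ * (∑ j, K i j * D j) - D i)) ≤ -(1 - γ) * ∑ i, d i * D i ^ 2 := by
  have h1 : ∑ i, ∑ j, d i * K i j * (D i * D j) ≤ ∑ i, d i * D i ^ 2 := by
    calc ∑ i, ∑ j, d i * K i j * (D i * D j)
        ≤ ∑ i, ∑ j, (d i * K i j * D i ^ 2 / 2 + d i * K i j * D j ^ 2 / 2) := by
          refine Finset.sum_le_sum fun i _ => Finset.sum_le_sum fun j _ => ?_
          nlinarith [mul_nonneg (mul_nonneg (h.1 i) (hK0 i j)) (sq_nonneg (D i - D j))]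
      _ = (∑ i, d i * D i ^ 2) / 2 + (∑ i, d i * D i ^ 2) / 2 := by
          simp only [Finset.sum_add_distrib]
          congr 1
          · rw [Finset.sum_div]
            refine Finset.sum_congr rfl fun i _ => ?_
            rw [← Finset.sum_div, ← Finset.sum_mul, ← Finset.mul_sum, hK1 i, mul_one]
          · rw [Finset.sum_comm, Finset.sum_div]
            refine Finset.sum_congr rfl fun j _ => ?_
            rw [← Finset.sum_div, ← Finset.sum_mul, ← h.2.2 j]
      _ = _ := by ring
  have h2 : ∑ i, D i * (d i * (γ * (∑ j, K i j * D j) - D i))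
      = γ * ∑ i, ∑ j, d i * K i j * (D i * D j) - ∑ i, d i * D i ^ 2 := by
    rw [Finset.mul_sum, ← Finset.sum_sub_distrib]
    refine Finset.sum_congr rfl fun i _ => ?_
    have : ∑ j, d i * K i j * (D i * D j) = d i * D i * ∑ j, K i j * D j := by
      rw [Finset.mul_sum]
      exact Finset.sum_congr rfl fun j _ => by ring
    rw [this]
    ring
  rw [h2]
  nlinarith [mul_le_mul_of_nonneg_left h1 hγ]

end Averaging

section Policies

variable {X A : Type*} [Fintype A]

lemma softmaxPol_pos (θ : X → A → ℝ) (x : X) (a : A) : 0 < softmaxPol θ x a :=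
  div_pos (Real.exp_pos _)
    (Finset.sum_pos (fun _ _ => Real.exp_pos _) ⟨a, Finset.mem_univ a⟩)

lemma sum_softmaxPol [Nonempty A] (θ : X → A → ℝ) (x : X) : ∑ a, softmaxPol θ x a = 1 := by
  have h : 0 < ∑ a', Real.exp (θ x a') :=
    Finset.sum_pos (fun _ _ => Real.exp_pos _) Finset.univ_nonempty
  simp only [softmaxPol]
  rw [← Finset.sum_div, div_self h.ne']

lemma isPolicy_softmaxPol [Nonempty A] (θ : X → A → ℝ) : IsPolicy (softmaxPol θ) :=
  ⟨fun x a => (softmaxPol_pos θ x a).le, sum_softmaxPol θ⟩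

lemma isPolicy_explorePol [Nonempty A] {η : ℝ} (h0 : 0 ≤ η) (h1 : η ≤ 1) (θ : X → A → ℝ) :
    IsPolicy (explorePol η θ) := by
  refine ⟨fun x a => ?_, fun x => ?_⟩
  · have := (softmaxPol_pos θ x a).le
    have h2 : 0 ≤ 1 - η := by linarith
    unfold explorePol
    positivity
  · simp only [explorePol]
    rw [Finset.sum_add_distrib, ← Finset.mul_sum, sum_softmaxPol]
    simp only [Finset.sum_const, Finset.card_univ, nsmul_eq_mul]
    have : (Fintype.card A : ℝ) ≠ 0 := by exact_mod_cast Fintype.card_ne_zero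
    field_simp
    ring

lemma IsPolicy.le_one {f : X → A → ℝ} (hf : IsPolicy f) (x : X) (a : A) : f x a ≤ 1 := by
  rw [← hf.2 x]
  exact Finset.single_le_sum (fun b _ => hf.1 x b) (Finset.mem_univ a)

lemma IsPolicy.sum_mul_le {f : X → A → ℝ} (hf : IsPolicy f) (x : X) {u : A → ℝ} {c : ℝ}
    (h : ∀ a, u a ≤ c) : ∑ a, f x a * u a ≤ c := by
  calc ∑ a, f x a * u a ≤ ∑ a, f x a * c :=
        Finset.sum_le_sum fun a _ => mul_le_mul_of_nonneg_left (h a) (hf.1 x a)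
    _ = c := by rw [← Finset.sum_mul, hf.2 x, one_mul]

lemma IsPolicy.abs_sum_mul_le {f : X → A → ℝ} (hf : IsPolicy f) (x : X) {u : A → ℝ} {c : ℝ}
    (h : ∀ a, |u a| ≤ c) : |∑ a, f x a * u a| ≤ c := by
  refine abs_le.2 ⟨?_, hf.sum_mul_le x fun a => (abs_le.1 (h a)).2⟩
  have := hf.sum_mul_le x (u := fun a => -u a) (c := c) fun a => by
    have := (abs_le.1 (h a)).1
    linarith
  simp only [mul_neg, Finset.sum_neg_distrib] at this
  linarith

lemma hasDerivAt_softmaxPol [Nonempty A] {θ : ℝ → X → A → ℝ} {θ' : X → A → ℝ} {t : ℝ}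
    (h : ∀ x a, HasDerivAt (fun s => θ s x a) (θ' x a) t) (x : X) (a : A) :
    HasDerivAt (fun s => softmaxPol (θ s) x a)
      (softmaxPol (θ t) x a * (θ' x a - ∑ b, softmaxPol (θ t) x b * θ' x b)) t := by
  have hZ : 0 < ∑ a', Real.exp (θ t x a') :=
    Finset.sum_pos (fun _ _ => Real.exp_pos _) Finset.univ_nonempty
  have h1 := (h x a).exp
  have h2 : HasDerivAt (fun s => ∑ a', Real.exp (θ s x a'))
      (∑ a', Real.exp (θ t x a') * θ' x a') t :=
    HasDerivAt.fun_sum fun b _ => (h x b).exp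
  have h3 := h1.fun_div h2 hZ.ne'
  refine h3.congr_deriv ?_
  have : ∑ b, Real.exp (θ t x b) / (∑ a', Real.exp (θ t x a')) * θ' x b
      = (∑ b, Real.exp (θ t x b) * θ' x b) / (∑ a', Real.exp (θ t x a')) := by
    rw [Finset.sum_div]
    exact Finset.sum_congr rfl fun b _ => by ring
  simp only [softmaxPol]
  rw [this]
  field_simp

end Policies

section ActionValues

variable {X A : Type*} [Fintype X] [Fintype A] {p : X → A → X → ℝ} {γ : ℝ}

lemma le_of_action_bellman_le [Nonempty X] [Nonempty A] (hp : ∀ x, IsPolicy (p x))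
    {f : X → A → ℝ} (hf : IsPolicy f)
    (hγ0 : 0 ≤ γ) (hγ1 : γ < 1) {D : X → A → ℝ} {u : ℝ}
    (h : ∀ x a, D x a ≤ u + γ * ∑ x', p x a x' * ∑ a', f x' a' * D x' a') (x : X) (a : A) :
    D x a ≤ u / (1 - γ) :=
  le_div_of_le_add_mul_average hγ0 hγ1
    (fun (D : X × A → ℝ) ξ => ∑ x', p ξ.1 ξ.2 x' * ∑ a', f x' a' * D (x', a'))
    (fun _ _ hD ξ => (hp ξ.1).sum_mul_le ξ.2 fun x' => hf.sum_mul_le x' fun a' => hD (x', a'))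
    (fun ξ => D ξ.1 ξ.2) u (fun ξ => h ξ.1 ξ.2) (x, a)

lemma le_of_state_bellman_le [Nonempty X] (hp : ∀ x, IsPolicy (p x))
    {f : X → A → ℝ} (hf : IsPolicy f) (hγ0 : 0 ≤ γ) (hγ1 : γ < 1) {D : X → ℝ} {u : ℝ}
    (h : ∀ x, D x ≤ u + γ * ∑ a, f x a * ∑ x', p x a x' * D x') (x : X) :
    D x ≤ u / (1 - γ) :=
  le_div_of_le_add_mul_average hγ0 hγ1
    (fun (D : X → ℝ) x => ∑ a, f x a * ∑ x', p x a x' * D x')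
    (fun _ _ hD x => hf.sum_mul_le x fun a => (hp x).sum_mul_le a fun x' => hD x')
    D u h x

lemma abs_le_of_action_bellman [Nonempty X] [Nonempty A] (hp : ∀ x, IsPolicy (p x))
    {f : X → A → ℝ} (hf : IsPolicy f)
    (hγ0 : 0 ≤ γ) (hγ1 : γ < 1) {D w : X → A → ℝ} {u : ℝ} (hw : ∀ x a, |w x a| ≤ u)
    (h : ∀ x a, D x a = w x a + γ * ∑ x', p x a x' * ∑ a', f x' a' * D x' a') (x : X) (a : A) :
    |D x a| ≤ u / (1 - γ) := by
  refine abs_le.2 ⟨?_, le_of_action_bellman_le hp hf hγ0 hγ1 (fun x a => ?_) x a⟩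
  · have := le_of_action_bellman_le hp hf hγ0 hγ1 (D := fun x a => -D x a) (u := u)
      (fun x a => ?_) x a
    · linarith
    · have h1 := (abs_le.1 (hw x a)).1
      have h2 := h x a
      simp only [mul_neg, Finset.sum_neg_distrib]
      linarith
  · have h1 := (abs_le.1 (hw x a)).2
    have h2 := h x a
    linarith

lemma hasDerivAt_actionValue [Nonempty X] [Nonempty A] [DecidableEq X] [DecidableEq A]
    (hp : ∀ x, IsPolicy (p x)) (hγ0 : 0 ≤ γ) (hγ1 : γ < 1) {r : X → A → ℝ}
    {h q : ℝ → X → A → ℝ} (hh : ∀ s, IsPolicy (h s))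
    (hq : ∀ s x a, q s x a = r x a + γ * ∑ x', p x a x' * ∑ a', h s x' a' * q s x' a')
    {t : ℝ} {h' : X → A → ℝ} (hh' : ∀ x a, HasDerivAt (fun s => h s x a) (h' x a) t) :
    ∃ q' : X → A → ℝ, (∀ x a, HasDerivAt (fun s => q s x a) (q' x a) t) ∧
      ∀ x a, q' x a =
        γ * ∑ x', p x a x' * ∑ a', (h' x' a' * q t x' a' + h t x' a' * q' x' a') := by
  let K : ℝ → Matrix (X × A) (X × A) ℝ := fun s =>
    Matrix.of fun ξ ξ' => p ξ.1 ξ.2 ξ'.1 * h s ξ'.1 ξ'.2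
  have hK : ∀ s (v : X × A → ℝ) ξ, (K s).mulVec v ξ
      = ∑ x', p ξ.1 ξ.2 x' * ∑ a', h s x' a' * v (x', a') := by
    intro s v ξ
    simp only [K, Matrix.mulVec, dotProduct, Matrix.of_apply, Fintype.sum_prod_type,
      Finset.mul_sum, mul_assoc]
  have hdiff : ∀ ξ : X × A, DifferentiableAt ℝ (fun s => q s ξ.1 ξ.2) t := by
    refine differentiableAt_of_mulVec_eq (fun s => 1 - γ • K s) (fun ξ => r ξ.1 ξ.2)
      (fun s ξ => q s ξ.1 ξ.2) t (fun ξ ξ' => ?_) (fun s hdet => ?_) (fun s => ?_)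
    · simp only [Matrix.sub_apply, Matrix.smul_apply, smul_eq_mul, K, Matrix.of_apply]
      exact (((hh' ξ'.1 ξ'.2).differentiableAt.const_mul _).const_mul _).const_sub _
    · obtain ⟨v, hv0, hv⟩ := Matrix.exists_mulVec_eq_zero_iff.2 hdet
      refine hv0 (funext fun ξ => ?_)
      have h1 : ∀ x a, v (x, a)
          = 0 + γ * ∑ x', p x a x' * ∑ a', h s x' a' * v (x', a') := by
        intro x a
        have h2 := congrFun hv (x, a)
        rw [Matrix.sub_mulVec, Matrix.one_mulVec, Matrix.smul_mulVec] at h2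
        simp only [Pi.sub_apply, Pi.smul_apply, smul_eq_mul, Pi.zero_apply, hK] at h2
        linarith
      have h3 := abs_le_of_action_bellman hp (hh s) hγ0 hγ1 (D := fun x a => v (x, a))
        (w := fun _ _ => 0) (u := 0) (by simp) h1 ξ.1 ξ.2
      simpa using h3
    · funext ξ
      rw [Matrix.sub_mulVec, Matrix.one_mulVec, Matrix.smul_mulVec]
      simp only [Pi.sub_apply, Pi.smul_apply, smul_eq_mul, hK]
      have := hq s ξ.1 ξ.2
      linarith
  refine ⟨fun x a => deriv (fun s => q s x a) t, fun x a => (hdiff (x, a)).hasDerivAt, ?_⟩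
  intro x a
  have h1 : HasDerivAt
      (fun s => r x a + γ * ∑ x', p x a x' * ∑ a', h s x' a' * q s x' a')
      (γ * ∑ x', p x a x' * ∑ a',
        (h' x' a' * q t x' a' + h t x' a' * deriv (fun s => q s x' a') t)) t := by
    refine HasDerivAt.const_add _ (HasDerivAt.const_mul _ ?_)
    refine HasDerivAt.fun_sum fun x' _ => HasDerivAt.const_mul _ ?_
    exact HasDerivAt.fun_sum fun a' _ => (hh' x' a').mul (hdiff (x', a')).hasDerivAt
  have h2 : (fun s => q s x a)
      = fun s => r x a + γ * ∑ x', p x a x' * ∑ a', h s x' a' * q s x' a' :=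
    funext fun s => hq s x a
  exact (h2 ▸ h1 : HasDerivAt (fun s => q s x a) _ t).deriv

lemma abs_sum_mul_le_card {u v : A → ℝ} {c d : ℝ} (hu : ∀ a, |u a| ≤ c) (hc : 0 ≤ c)
    (hv : ∀ a, |v a| ≤ d) : |∑ a, u a * v a| ≤ Fintype.card A * (c * d) := by
  refine (Finset.abs_sum_le_sum_abs _ _).trans ?_
  calc ∑ a, |u a * v a| ≤ ∑ _a : A, c * d := by
        refine Finset.sum_le_sum fun a _ => ?_
        rw [abs_mul]
        exact mul_le_mul (hu a) (hv a) (abs_nonneg _) hc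
    _ = _ := by simp

lemma abs_deriv_actionValue_le [Nonempty X] [Nonempty A]
    (hp : ∀ x, IsPolicy (p x)) (hγ0 : 0 ≤ γ) (hγ1 : γ < 1)
    {h h' q q' : X → A → ℝ} (hh : IsPolicy h) {B H : ℝ} (hq : ∀ x a, |q x a| ≤ B)
    (hh' : ∀ x a, |h' x a| ≤ H) (hH : 0 ≤ H)
    (hq' : ∀ x a, q' x a =
        γ * ∑ x', p x a x' * ∑ a', (h' x' a' * q x' a' + h x' a' * q' x' a'))
    (x : X) (a : A) : |q' x a| ≤ Fintype.card A * (H * B) / (1 - γ) := by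
  refine abs_le_of_action_bellman hp hh hγ0 hγ1
    (w := fun x a => γ * ∑ x', p x a x' * ∑ a', h' x' a' * q x' a') (fun x a => ?_)
    (fun x a => ?_) x a
  · have h1 := (hp x).abs_sum_mul_le a (u := fun x' => ∑ a', h' x' a' * q x' a')
      fun x' => abs_sum_mul_le_card (hh' x') hH (hq x')
    rw [abs_mul, abs_of_nonneg hγ0]
    exact (mul_le_of_le_one_left (abs_nonneg _) hγ1.le).trans h1
  · rw [hq' x a]
    simp only [Finset.sum_add_distrib, mul_add]

lemma neg_le_deriv_stateValue [Nonempty X]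
    (hp : ∀ x, IsPolicy (p x)) (hγ0 : 0 ≤ γ) (hγ1 : γ < 1)
    {h h' q q' : X → A → ℝ} (hh : IsPolicy h) {u : ℝ}
    (hu : ∀ x, -u ≤ ∑ a, h' x a * q x a)
    (hq' : ∀ x a, q' x a =
        γ * ∑ x', p x a x' * ∑ a', (h' x' a' * q x' a' + h x' a' * q' x' a'))
    (x : X) : -(u / (1 - γ)) ≤ ∑ a, (h' x a * q x a + h x a * q' x a) := by
  have := le_of_state_bellman_le hp hh hγ0 hγ1
    (D := fun x => -∑ a, (h' x a * q x a + h x a * q' x a)) (u := u) (fun x => ?_) x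
  · linarith
  · have h1 : ∑ a, h x a * q' x a = γ * ∑ a, h x a *
        ∑ x', p x a x' * ∑ a, (h' x' a * q x' a + h x' a * q' x' a) := by
      rw [Finset.mul_sum]
      refine Finset.sum_congr rfl fun a _ => ?_
      rw [hq' x a]
      ring
    simp only [mul_neg, Finset.sum_neg_distrib]
    rw [Finset.sum_add_distrib, h1]
    linarith [hu x]

lemma abs_actionValue_sub_le [Nonempty X] [Nonempty A]
    (hp : ∀ x, IsPolicy (p x)) (hγ0 : 0 ≤ γ) (hγ1 : γ < 1) {r : X → A → ℝ}
    {f g qf qg : X → A → ℝ} (hg : IsPolicy g)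
    (hqf : ∀ x a, qf x a = r x a + γ * ∑ x', p x a x' * ∑ a', f x' a' * qf x' a')
    (hqg : ∀ x a, qg x a = r x a + γ * ∑ x', p x a x' * ∑ a', g x' a' * qg x' a')
    {B H : ℝ} (hB : ∀ x a, |qf x a| ≤ B) (hH : 0 ≤ H) (hfg : ∀ x a, |g x a - f x a| ≤ H)
    (x : X) (a : A) : |qg x a - qf x a| ≤ Fintype.card A * (H * B) / (1 - γ) := by
  refine abs_le_of_action_bellman hp hg hγ0 hγ1 (D := fun x a => qg x a - qf x a)
    (w := fun x a => γ * ∑ x', p x a x' * ∑ a', (g x' a' - f x' a') * qf x' a')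
    (fun x a => ?_) (fun x a => ?_) x a
  · have h1 := (hp x).abs_sum_mul_le a (u := fun x' => ∑ a', (g x' a' - f x' a') * qf x' a')
      fun x' => abs_sum_mul_le_card (hfg x') hH (hB x')
    rw [abs_mul, abs_of_nonneg hγ0]
    exact (mul_le_of_le_one_left (abs_nonneg _) hγ1.le).trans h1
  · rw [hqg x a, hqf x a]
    simp only [mul_sub, sub_mul, Finset.sum_sub_distrib]
    ring

end ActionValues

lemma hasDerivAt_log_one_add {t : ℝ} (ht : 0 ≤ t) :
    HasDerivAt (fun s : ℝ => Real.log (s + 1)) (zetaT t) t := by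
  have h := ((hasDerivAt_id t).add_const (1 : ℝ)).log (by simp only [id]; positivity)
  simpa [zetaT, add_comm] using h

section Bandit

variable {A : Type*} [Fintype A]

lemma limit_le_of_softmax_flow
    {θ f q : ℝ → A → ℝ} {k : ℝ → ℝ} {c v T₀ : ℝ} {qlim : A → ℝ}
    (hT₀ : 0 ≤ T₀) (hc : 0 < c) (hk : ∀ t, T₀ ≤ t → c * zetaT t ≤ k t)
    (hf : ∀ t a, f t a = Real.exp (θ t a) / ∑ b, Real.exp (θ t b))
    (hθ : ∀ t, T₀ ≤ t → ∀ a, HasDerivAt (fun s => θ s a)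
      (k t * f t a * (q t a - ∑ b, f t b * q t b)) t)
    (hq : ∀ a, Tendsto (fun t => q t a) atTop (nhds (qlim a)))
    (hv : Tendsto (fun t => ∑ b, f t b * q t b) atTop (nhds v)) (a₀ : A) : qlim a₀ ≤ v := by
  by_contra! hlt
  have : Nonempty A := ⟨a₀⟩
  obtain ⟨N, hN⟩ : ∃ N : ℝ, N = (Fintype.card A : ℝ) := ⟨_, rfl⟩
  have hN1 : 1 ≤ N := by
    rw [hN]
    exact_mod_cast Nat.one_le_iff_ne_zero.2 Fintype.card_ne_zero
  have hNpos : 0 < N := by linarith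
  set α : ℝ → A → ℝ := fun t a => q t a - ∑ b, f t b * q t b with hα
  have hαlim : ∀ a, Tendsto (fun t => α t a) atTop (nhds (qlim a - v)) := fun a => (hq a).sub hv
  have hZ : ∀ t, 0 < ∑ b, Real.exp (θ t b) := fun t =>
    Finset.sum_pos (fun _ _ => Real.exp_pos _) Finset.univ_nonempty
  have hfpos : ∀ t a, 0 < f t a := fun t a => by
    rw [hf]
    exact div_pos (Real.exp_pos _) (hZ t)
  have hfsum : ∀ t, ∑ a, f t a = 1 := fun t => by
    simp only [hf]
    rw [← Finset.sum_div, div_self (hZ t).ne']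
  have hfle : ∀ t a b C, Real.exp (θ t a) ≤ C * Real.exp (θ t b) → f t a ≤ C * f t b := by
    intro t a b C h
    rw [hf, hf, ← mul_div_assoc]
    exact div_le_div_of_nonneg_right h (hZ t).le
  have hzero : ∀ t, ∑ a, f t a * α t a = 0 := fun t => by
    simp only [hα, mul_sub, Finset.sum_sub_distrib]
    rw [← Finset.sum_mul, hfsum, one_mul, sub_self]
  have hkpos : ∀ t, T₀ ≤ t → 0 < k t := fun t ht =>
    lt_of_lt_of_le (mul_pos hc (inv_pos.2 (by linarith))) (hk t ht)
  -- the actions of positive limiting advantage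
  set G : Finset A := Finset.univ.filter fun a => v < qlim a with hG
  have ha₀G : a₀ ∈ G := by simpa [hG] using hlt
  obtain ⟨am, hamG, ham⟩ := G.exists_min_image (fun a => qlim a - v) ⟨a₀, ha₀G⟩
  set κ : ℝ := qlim am - v with hκ
  have hκpos : 0 < κ := by
    have : v < qlim am := by simpa [hG] using hamG
    linarith
  set ε : ℝ := κ / (8 * N) with hε
  have hεpos : 0 < ε := by positivity
  have hεκ : ε ≤ κ / 8 := by
    rw [hε]
    exact div_le_div_of_nonneg_left hκpos.le (by norm_num) (by linarith)
  have hev : ∀ᶠ t in atTop, ∀ a, (v < qlim a → κ / 2 ≤ α t a) ∧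
      (qlim a < v → α t a ≤ 0) ∧ |α t a - (qlim a - v)| ≤ ε := by
    rw [eventually_all]
    intro a
    have h3 : ∀ᶠ t in atTop, |α t a - (qlim a - v)| ≤ ε := by
      filter_upwards [(Metric.tendsto_nhds.1 (hαlim a)) ε hεpos] with t ht
      exact ht.le
    refine Filter.Eventually.and ?_ (Filter.Eventually.and ?_ h3)
    · by_cases h : v < qlim a
      · have h1 : κ / 2 < qlim a - v := by
          have := ham a (by simpa [hG] using h)
          linarith
        filter_upwards [(hαlim a).eventually (lt_mem_nhds h1)] with t ht _ using ht.le
      · simp [h]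
    · by_cases h : qlim a < v
      · filter_upwards [(hαlim a).eventually (gt_mem_nhds (sub_neg.2 h))] with t ht _ using ht.le
      · simp [h]
  obtain ⟨T₁, hT₁⟩ := eventually_atTop.1 hev
  set T := max T₀ T₁ with hT
  have hTT : ∀ t, T ≤ t → T₀ ≤ t ∧ T₁ ≤ t := fun t ht =>
    ⟨(le_max_left _ _).trans ht, (le_max_right _ _).trans ht⟩
  have hcont : ∀ t, T₀ ≤ t → ∀ a, ContinuousAt (fun s => θ s a) t := fun t ht a =>
    (hθ t ht a).continuousAt
  have hmono : MonotoneOn (fun s => θ s a₀) (Ici T) := by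
    refine monotoneOn_of_hasDerivWithinAt_nonneg (convex_Ici T)
      (f' := fun t => k t * f t a₀ * α t a₀)
      (fun t ht => (hcont t (hTT t ht).1 a₀).continuousWithinAt)
      (fun t ht => (hθ t (hTT t (interior_subset ht)).1 a₀).hasDerivWithinAt) fun t ht => ?_
    have ht' := hTT t (interior_subset ht)
    have h1 := ((hT₁ t ht'.2) a₀).1 hlt
    have h2 := (hkpos t ht'.1).le
    have h3 := (hfpos t a₀).le
    have h4 : 0 ≤ α t a₀ := by linarith
    positivity
  have hanti : ∀ a, qlim a < v → AntitoneOn (fun s => θ s a) (Ici T) := by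
    intro a ha
    refine antitoneOn_of_hasDerivWithinAt_nonpos (convex_Ici T)
      (f' := fun t => k t * f t a * α t a)
      (fun t ht => (hcont t (hTT t ht).1 a).continuousWithinAt)
      (fun t ht => (hθ t (hTT t (interior_subset ht)).1 a).hasDerivWithinAt) fun t ht => ?_
    have ht' := hTT t (interior_subset ht)
    have h1 := ((hT₁ t ht'.2) a).2.1 ha
    have h2 := (hkpos t ht'.1).le
    have h3 := (hfpos t a).le
    exact mul_nonpos_of_nonneg_of_nonpos (mul_nonneg h2 h3) h1
  have horder : ∀ a, qlim a ≤ v → ∀ t₁, T ≤ t₁ → θ t₁ a ≤ θ t₁ a₀ →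
      ∀ t, t₁ ≤ t → θ t a ≤ θ t a₀ := by
    intro a ha t₁ ht₁ hle t ht
    have key := image_le_of_deriv_right_lt_deriv_boundary (f := fun s => θ s a - θ s a₀)
      (f' := fun s => k s * f s a * α s a - k s * f s a₀ * α s a₀) (a := t₁) (b := t)
      (B := fun _ => 0) (B' := fun _ => 0)
      (fun s hs => ((hcont s (hTT s (ht₁.trans hs.1)).1 a).sub
        (hcont s (hTT s (ht₁.trans hs.1)).1 a₀)).continuousWithinAt)
      (fun s hs => ((hθ s (hTT s (ht₁.trans hs.1)).1 a).sub
        (hθ s (hTT s (ht₁.trans hs.1)).1 a₀)).hasDerivWithinAt)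
      (by simpa using hle) (fun s => hasDerivAt_const s 0)
      (fun s hs heq => by
        have hs' := hTT s (ht₁.trans hs.1)
        have h0 : θ s a = θ s a₀ := sub_eq_zero.1 heq
        have hff : f s a = f s a₀ := by rw [hf, hf, h0]
        have h1 := ((hT₁ s hs'.2) a₀).1 hlt
        have h2 := (abs_le.1 ((hT₁ s hs'.2) a).2.2).2
        have h3 := mul_pos (hkpos s hs'.1) (hfpos s a₀)
        rw [hff]
        nlinarith) ⟨ht, le_rfl⟩
    linarith
  -- the remaining actions whose parameter stays bounded below
  set B : Finset A := Finset.univ.filter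
    fun a => qlim a ≤ v ∧ ∃ m, ∀ t, T ≤ t → m ≤ θ t a with hB
  have hother : ∀ a, a ∉ G → a ∉ B → ∀ᶠ t in atTop,
      f t a ≤ f t a₀ ∧ -(ε * f t a₀) ≤ f t a * α t a := by
    intro a haG haB
    have hav : qlim a ≤ v := by simpa [hG] using haG
    have hub : ∀ m, ∃ t, T ≤ t ∧ θ t a < m := by
      simpa [hB, hav] using haB
    obtain ⟨t₁, ht₁, hlt₁⟩ := hub (θ T a₀)
    have hle : ∀ t, t₁ ≤ t → f t a ≤ f t a₀ := by
      intro t ht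
      have h1 := horder a hav t₁ ht₁
        (hlt₁.le.trans (hmono (mem_Ici.2 le_rfl) (mem_Ici.2 ht₁) ht₁)) t ht
      have := hfle t a a₀ 1 (by simpa using h1)
      simpa using this
    rcases hav.lt_or_eq with hneg | heq
    · set M := v - qlim a + ε with hM
      have hMpos : 0 < M := by linarith
      obtain ⟨t₂, ht₂, hlt₂⟩ := hub (θ T a₀ + Real.log (ε / M))
      filter_upwards [eventually_ge_atTop t₁, eventually_ge_atTop t₂] with t h₁ h₂
      refine ⟨hle t h₁, ?_⟩
      have hTt : T ≤ t := ht₁.trans h₁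
      have h1 : θ t a ≤ θ t a₀ + Real.log (ε / M) := by
        have e1 := hanti a hneg (mem_Ici.2 ht₂) (mem_Ici.2 (ht₂.trans h₂)) h₂
        have e2 := hmono (mem_Ici.2 le_rfl) (mem_Ici.2 hTt) hTt
        simp only at e1 e2
        linarith
      have h2 : f t a ≤ (ε / M) * f t a₀ := by
        refine hfle t a a₀ _ ?_
        calc Real.exp (θ t a) ≤ Real.exp (θ t a₀ + Real.log (ε / M)) := Real.exp_le_exp.2 h1
          _ = _ := by rw [Real.exp_add, Real.exp_log (by positivity), mul_comm]
      have h3 : -M ≤ α t a := by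
        have := (abs_le.1 ((hT₁ t (hTT t hTt).2) a).2.2).1
        linarith
      have h4 : M * f t a ≤ ε * f t a₀ := by
        calc M * f t a ≤ M * ((ε / M) * f t a₀) := mul_le_mul_of_nonneg_left h2 hMpos.le
          _ = _ := by field_simp
      nlinarith [hfpos t a]
    · filter_upwards [eventually_ge_atTop t₁] with t h₁
      refine ⟨hle t h₁, ?_⟩
      have h3 := (abs_le.1 ((hT₁ t (hTT t (ht₁.trans h₁)).2) a).2.2).1
      rw [heq] at h3
      nlinarith [hle t h₁, hfpos t a, hfpos t a₀]
  have hother' : ∀ᶠ t in atTop, ∀ a, a ∉ G → a ∉ B →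
      f t a ≤ f t a₀ ∧ -(ε * f t a₀) ≤ f t a * α t a := by
    rw [eventually_all]
    intro a
    by_cases h1 : a ∈ G
    · simp [h1]
    by_cases h2 : a ∈ B
    · simp [h2]
    filter_upwards [hother a h1 h2] with t ht _ _ using ht
  obtain ⟨T₂, hT₂⟩ := eventually_atTop.1 hother'
  set T₃ := max T T₂ with hT₃
  have hTT₃ : ∀ t, T₃ ≤ t → T ≤ t ∧ T₂ ≤ t := fun t ht =>
    ⟨(le_max_left _ _).trans ht, (le_max_right _ _).trans ht⟩
  have hGB : ∀ a ∈ B, a ∉ G := by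
    intro a ha haG
    simp only [hB, hG, Finset.mem_filter, Finset.mem_univ, true_and] at ha haG
    linarith [ha.1]
  have hsplit : ∀ F : A → ℝ, ∑ a, F a = ∑ a ∈ G, F a + ∑ a ∈ B, F a
      + ∑ a ∈ Finset.univ.filter (fun a => a ∉ G ∧ a ∉ B), F a := by
    intro F
    rw [← Finset.sum_filter_add_sum_filter_not Finset.univ (fun a => a ∈ G) F]
    rw [← Finset.sum_filter_add_sum_filter_not
      (Finset.univ.filter fun a => a ∉ G) (fun a => a ∈ B) F, ← add_assoc]
    rw [Finset.filter_filter, Finset.filter_filter]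
    congr 2
    · congr 1
      ext a
      simp
    · congr 1
      ext a
      simp only [Finset.mem_filter, Finset.mem_univ, true_and]
      exact ⟨fun h => h.2, fun h => ⟨hGB a h, h⟩⟩
  have hfG : ∀ t, f t a₀ ≤ ∑ a ∈ G, f t a := fun t =>
    Finset.single_le_sum (fun a _ => (hfpos t a).le) ha₀G
  have hcardle : ∀ s : Finset A, (s.card : ℝ) ≤ N := fun s => by
    rw [hN]
    exact_mod_cast Finset.card_le_univ s
  have hBneg : ∀ t, T₃ ≤ t → ∑ a ∈ B, f t a * α t a ≤ -(κ / 4 * ∑ a ∈ G, f t a) := by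
    intro t ht
    have ht' := hTT₃ t ht
    have h0 := hzero t
    rw [hsplit] at h0
    have h1 : κ / 2 * ∑ a ∈ G, f t a ≤ ∑ a ∈ G, f t a * α t a := by
      rw [Finset.mul_sum]
      refine Finset.sum_le_sum fun a ha => ?_
      have e1 := ((hT₁ t (hTT t ht'.1).2) a).1 (by simpa [hG] using ha)
      nlinarith [hfpos t a]
    have h2 : -(N * (ε * f t a₀)) ≤
        ∑ a ∈ Finset.univ.filter (fun a => a ∉ G ∧ a ∉ B), f t a * α t a := by
      have e1 := Finset.card_nsmul_le_sum
        (Finset.univ.filter (fun a => a ∉ G ∧ a ∉ B)) (fun a => f t a * α t a)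
        (-(ε * f t a₀)) (fun a ha => by
          simp only [Finset.mem_filter, Finset.mem_univ, true_and] at ha
          exact (hT₂ t ht'.2 a ha.1 ha.2).2)
      rw [nsmul_eq_mul] at e1
      refine le_trans ?_ e1
      have e2 := hcardle (Finset.univ.filter (fun a => a ∉ G ∧ a ∉ B))
      have e3 : 0 < ε * f t a₀ := mul_pos hεpos (hfpos t a₀)
      nlinarith
    have h3 : N * (ε * f t a₀) = κ / 8 * f t a₀ := by
      rw [hε]
      field_simp
    have h4 := hfG t
    have h5 := hfpos t a₀
    nlinarith
  choose! m hm using fun a (ha : a ∈ B) => (Finset.mem_filter.1 ha).2.2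
  have hS : ∀ t, T₃ ≤ t → HasDerivAt (fun s => ∑ a ∈ B, θ s a)
      (k t * ∑ a ∈ B, f t a * α t a) t := by
    intro t ht
    have := HasDerivAt.fun_sum (u := B) fun a _ => hθ t (hTT t (hTT₃ t ht).1).1 a
    refine this.congr_deriv ?_
    rw [Finset.mul_sum]
    exact Finset.sum_congr rfl fun a _ => by ring
  have hSanti : AntitoneOn (fun s => ∑ a ∈ B, θ s a) (Ici T₃) := by
    refine antitoneOn_of_hasDerivWithinAt_nonpos (convex_Ici T₃)
      (fun t ht => (hS t ht).continuousAt.continuousWithinAt)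
      (fun t ht => (hS t (interior_subset ht)).hasDerivWithinAt) fun t ht => ?_
    have ht' := interior_subset ht
    refine mul_nonpos_of_nonneg_of_nonpos (hkpos t (hTT t (hTT₃ t ht').1).1).le ?_
    have h1 := hBneg t ht'
    have h2 := hfG t
    have h3 := hfpos t a₀
    nlinarith
  have hSlow : ∀ t, T₃ ≤ t → ∑ a ∈ B, m a ≤ ∑ a ∈ B, θ t a := fun t ht =>
    Finset.sum_le_sum fun a ha => hm a ha t (hTT₃ t ht).1
  have hCex : ∃ C : ℝ, 0 ≤ C ∧ ∀ a ∈ B, ∀ t, T₃ ≤ t → f t a ≤ C * f t a₀ := by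
    have h1 : ∀ a ∈ B, ∀ t, T₃ ≤ t →
        θ t a ≤ ∑ b ∈ B, θ T₃ b + ∑ b ∈ B, |m b| := by
      intro a ha t ht
      have e1 := hSanti (mem_Ici.2 le_rfl) (mem_Ici.2 ht) ht
      have e2 : θ t a - m a ≤ ∑ b ∈ B, (θ t b - m b) :=
        Finset.single_le_sum (f := fun b => θ t b - m b)
          (fun b hb => sub_nonneg.2 (hm b hb t (hTT₃ t ht).1)) ha
      have e3 : m a - ∑ b ∈ B, m b ≤ ∑ b ∈ B, |m b| := by
        rw [← Finset.add_sum_erase B m ha, ← Finset.add_sum_erase B (fun b => |m b|) ha]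
        have := Finset.abs_sum_le_sum_abs m (B.erase a)
        have e4 := neg_abs_le (∑ b ∈ B.erase a, m b)
        have e5 := abs_nonneg (m a)
        linarith
      rw [Finset.sum_sub_distrib] at e2
      simp only at e1
      linarith
    refine ⟨Real.exp (∑ b ∈ B, θ T₃ b + ∑ b ∈ B, |m b| - θ T a₀), (Real.exp_pos _).le, ?_⟩
    intro a ha t ht
    refine hfle t a a₀ _ ?_
    rw [← Real.exp_add]
    refine Real.exp_le_exp.2 ?_
    have e1 := h1 a ha t ht
    have e2 := hmono (mem_Ici.2 le_rfl) (mem_Ici.2 (hTT₃ t ht).1) (hTT₃ t ht).1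
    simp only at e2
    linarith
  obtain ⟨C, hC0, hC⟩ := hCex
  set δ : ℝ := (1 + N * C + N)⁻¹ with hδ
  have hδpos : 0 < δ := by positivity
  have hmass : ∀ t, T₃ ≤ t → δ ≤ ∑ a ∈ G, f t a := by
    intro t ht
    have h0 := hfsum t
    rw [hsplit] at h0
    have h1 : ∑ a ∈ B, f t a ≤ N * (C * f t a₀) := by
      have e1 := Finset.sum_le_card_nsmul B (fun a => f t a) (C * f t a₀)
        fun a ha => hC a ha t ht
      rw [nsmul_eq_mul] at e1
      exact e1.trans (mul_le_mul_of_nonneg_right (hcardle B)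
        (mul_nonneg hC0 (hfpos t a₀).le))
    have h2 : ∑ a ∈ Finset.univ.filter (fun a => a ∉ G ∧ a ∉ B), f t a ≤ N * f t a₀ := by
      have e1 := Finset.sum_le_card_nsmul
        (Finset.univ.filter (fun a => a ∉ G ∧ a ∉ B)) (fun a => f t a) (f t a₀) fun a ha => by
          simp only [Finset.mem_filter, Finset.mem_univ, true_and] at ha
          exact (hT₂ t (hTT₃ t ht).2 a ha.1 ha.2).1
      rw [nsmul_eq_mul] at e1
      exact e1.trans (mul_le_mul_of_nonneg_right (hcardle _) (hfpos t a₀).le)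
    have h3 := hfG t
    have h4 : 0 ≤ N * C + N := by positivity
    rw [hδ, inv_le_iff_one_le_mul₀ (by positivity)]
    nlinarith
  have hlogS : AntitoneOn
      (fun s => ∑ a ∈ B, θ s a + c * (κ / 4 * δ) * Real.log (s + 1)) (Ici T₃) := by
    have hd : ∀ t, T₃ ≤ t → HasDerivAt
        (fun s => ∑ a ∈ B, θ s a + c * (κ / 4 * δ) * Real.log (s + 1))
        (k t * ∑ a ∈ B, f t a * α t a + c * (κ / 4 * δ) * zetaT t) t := fun t ht =>
      (hS t ht).add ((hasDerivAt_log_one_add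
        (hT₀.trans (hTT t (hTT₃ t ht).1).1)).const_mul _)
    refine antitoneOn_of_hasDerivWithinAt_nonpos (convex_Ici T₃)
      (fun t ht => (hd t ht).continuousAt.continuousWithinAt)
      (fun t ht => (hd t (interior_subset ht)).hasDerivWithinAt) fun t ht => ?_
    have ht' := interior_subset ht
    have hT₀t := (hTT t (hTT₃ t ht').1).1
    have h1 := hBneg t ht'
    have h2 := hmass t ht'
    have h3 := hk t hT₀t
    have h4 := hkpos t hT₀t
    have h5 : ∑ a ∈ B, f t a * α t a ≤ -(κ / 4 * δ) := by nlinarith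
    have h6 : 0 < κ / 4 * δ := by positivity
    nlinarith
  have hlog : Tendsto (fun s : ℝ => c * (κ / 4 * δ) * Real.log (s + 1)) atTop atTop :=
    (Real.tendsto_log_atTop.comp (tendsto_atTop_add_const_right _ _ tendsto_id)).const_mul_atTop
      (by positivity)
  obtain ⟨t, ht₁, ht₂⟩ := ((hlog.eventually_gt_atTop
    ((∑ a ∈ B, θ T₃ a + c * (κ / 4 * δ) * Real.log (T₃ + 1)) - ∑ a ∈ B, m a)).and
    (eventually_ge_atTop T₃)).exists
  have h1 := hlogS (mem_Ici.2 le_rfl) (mem_Ici.2 ht₂) ht₂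
  have h2 := hSlow t ht₂
  simp only at h1
  linarith

end Bandit

section Schedules

lemma zetaT_pos {t : ℝ} (ht : 0 ≤ t) : 0 < zetaT t := inv_pos.2 (by linarith)

lemma etaT_pos (t : ℝ) : 0 < etaT t := inv_pos.2 (by positivity)

lemma etaT_le_one (t : ℝ) : etaT t ≤ 1 := inv_le_one_of_one_le₀ (by nlinarith [sq_nonneg (Real.log (t + 1))])

lemma etaT_lt_one {t : ℝ} (ht : 0 < t) : etaT t < 1 := by
  have h : 0 < Real.log (t + 1) := Real.log_pos (by linarith)
  exact inv_lt_one_of_one_lt₀ (by nlinarith)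

lemma hasDerivAt_etaT {t : ℝ} (ht : 0 ≤ t) :
    ∃ η' : ℝ, HasDerivAt etaT η' t ∧ |η'| ≤ zetaT t := by
  have h1 := (((hasDerivAt_log_one_add ht).fun_pow 2).const_add 1).fun_inv (by positivity)
  refine ⟨_, h1, ?_⟩
  have hz := zetaT_pos ht
  set L := Real.log (t + 1)
  have hL : 0 < (1 + L ^ 2) ^ 2 := by positivity
  rw [abs_div, abs_neg, abs_of_pos hL, div_le_iff₀ hL]
  simp only [Nat.cast_ofNat, Nat.add_one_sub_one, pow_one]
  rw [abs_mul, abs_of_pos hz, mul_comm]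
  refine mul_le_mul_of_nonneg_left (abs_le.2 ⟨?_, ?_⟩) hz.le
  · nlinarith [sq_nonneg (L + 1), sq_nonneg (L ^ 2), sq_nonneg L]
  · nlinarith [sq_nonneg (L - 1), sq_nonneg (L ^ 2), sq_nonneg L]

lemma eventually_mul_zetaT_le_etaT_pow (C : ℝ) (n : ℕ) :
    ∀ᶠ t in atTop, C * zetaT t ≤ etaT t ^ n := by
  have h1 := Polynomial.tendsto_div_exp_atTop (Polynomial.C C * (1 + Polynomial.X ^ 2) ^ n)
  have h2 : Tendsto (fun t : ℝ => Real.log (t + 1)) atTop atTop :=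
    Real.tendsto_log_atTop.comp (tendsto_atTop_add_const_right _ _ tendsto_id)
  filter_upwards [(h1.comp h2).eventually (gt_mem_nhds one_pos), eventually_ge_atTop 0]
    with t ht h0
  have h3 : 0 < t + 1 := by linarith
  simp only [Function.comp, Real.exp_log h3, Polynomial.eval_mul, Polynomial.eval_C,
    Polynomial.eval_pow, Polynomial.eval_add, Polynomial.eval_one, Polynomial.eval_X] at ht
  rw [div_lt_one h3] at ht
  have h4 : 0 < (1 + Real.log (t + 1) ^ 2) ^ n := by positivity
  rw [zetaT, etaT, inv_pow, ← div_eq_mul_inv, ← one_div, div_le_div_iff₀ (by linarith) h4]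
  linarith

lemma le_mul_zetaT_of_deriv_le {Y Y' : ℝ → ℝ} {c C T₀ : ℝ} {n : ℕ} (hc : 0 < c)
    (hT₀ : 0 ≤ T₀) (hY : ∀ t, T₀ ≤ t → 0 ≤ Y t)
    (hd : ∀ t, T₀ ≤ t → HasDerivAt Y (Y' t) t)
    (hle : ∀ t, T₀ ≤ t →
      Y' t ≤ -(c * etaT t ^ n) * Y t + C * zetaT t * (Real.sqrt (Y t) + Y t)) :
    ∃ M T : ℝ, T₀ ≤ T ∧ ∀ t, T ≤ t → Y t ≤ M * zetaT t := by
  obtain ⟨T₁, hT₁⟩ := eventually_atTop.1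
    (((eventually_mul_zetaT_le_etaT_pow (4 * C / c) n).and
      (eventually_mul_zetaT_le_etaT_pow (8 / c) n)).and
      (eventually_mul_zetaT_le_etaT_pow (1 / c ^ 2) (n * 2)))
  set T := max T₀ T₁
  have hT : ∀ t, T ≤ t → T₀ ≤ t ∧ T₁ ≤ t := fun t ht =>
    ⟨(le_max_left _ _).trans ht, (le_max_right _ _).trans ht⟩
  set M := max ((1 + T) * Y T) (4 * C ^ 2 + 1) with hM
  have hM1 : 4 * C ^ 2 + 1 ≤ M := le_max_right _ _
  have hder : ∀ t, T ≤ t → HasDerivAt (fun s => (1 + s) * Y s) (1 * Y t + (1 + t) * Y' t) t :=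
    fun t ht => ((hasDerivAt_id t).const_add 1).mul (hd t (hT t ht).1)
  refine ⟨M, T, le_max_left _ _, fun t ht => ?_⟩
  have key := image_le_of_deriv_right_lt_deriv_boundary (f := fun s => (1 + s) * Y s)
    (f' := fun s => 1 * Y s + (1 + s) * Y' s) (a := T) (b := t)
    (B := fun _ => M) (B' := fun _ => 0)
    (fun s hs => (hder s hs.1).continuousAt.continuousWithinAt)
    (fun s hs => (hder s hs.1).hasDerivWithinAt)
    (le_max_left _ _) (fun s => hasDerivAt_const s M)
    (fun s hs heq => by
      have hs' := hT s hs.1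
      have hs0 : 0 ≤ s := hT₀.trans hs'.1
      obtain ⟨⟨e1, e2⟩, e3⟩ := hT₁ s hs'.2
      have hz := zetaT_pos hs0
      have hYz : Y s = M * zetaT s := by
        rw [zetaT, ← heq]
        field_simp
      have hzs : (1 + s) * zetaT s = 1 := mul_inv_cancel₀ (by linarith)
      have hle' := hle s hs'.1
      set w := c * etaT s ^ n with hw
      have hwpos : 0 < w := mul_pos hc (pow_pos (etaT_pos s) n)
      set z := zetaT s
      set y := Real.sqrt (Y s) with hy
      have hyy : y ^ 2 = Y s := Real.sq_sqrt (hY s hs'.1)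
      have e1' : 4 * (C * z) ≤ w := by
        have := mul_le_mul_of_nonneg_left e1 hc.le
        calc 4 * (C * z) = c * (4 * C / c * z) := by field_simp
          _ ≤ w := this
      have e2' : 8 * z ≤ w := by
        have := mul_le_mul_of_nonneg_left e2 hc.le
        calc 8 * z = c * (8 / c * z) := by field_simp
          _ ≤ w := this
      have e3' : z ≤ w ^ 2 := by
        have := mul_le_mul_of_nonneg_left e3 (sq_nonneg c)
        calc z = c ^ 2 * (1 / c ^ 2 * z) := by field_simp
          _ ≤ c ^ 2 * etaT s ^ (n * 2) := this
          _ = w ^ 2 := by rw [hw, mul_pow, pow_mul]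
      have h1 : C * z * y ≤ w / 4 * Y s + C ^ 2 * z * w := by
        have e4 : w * (C * z * y) ≤ w * (w / 4 * Y s + C ^ 2 * z * w) := by
          have e5 : C ^ 2 * z * z ≤ C ^ 2 * z * w ^ 2 :=
            mul_le_mul_of_nonneg_left e3' (by positivity)
          nlinarith [sq_nonneg (w * y / 2 - C * z)]
        exact le_of_mul_le_mul_left e4 hwpos
      have h2 : Y' s ≤ -(w / 2) * Y s + C ^ 2 * z * w := by
        have e6 := mul_le_mul_of_nonneg_right e1' (hY s hs'.1)
        nlinarith
      have h3 : (1 + s) * Y' s ≤ -(w / 2) * M + C ^ 2 * w := by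
        calc (1 + s) * Y' s ≤ (1 + s) * (-(w / 2) * Y s + C ^ 2 * z * w) :=
              mul_le_mul_of_nonneg_left h2 (by linarith)
          _ = ((1 + s) * z) * (-(w / 2) * M + C ^ 2 * w) := by rw [hYz]; ring
          _ = _ := by rw [hzs, one_mul]
      have hMpos : 0 < M := by nlinarith [sq_nonneg C]
      rw [one_mul, hYz]
      have h4 : M * z ≤ M * (w / 8) := mul_le_mul_of_nonneg_left (by linarith) hMpos.le
      have h5 : w * (C ^ 2) < w * (M * (3 / 8)) :=
        mul_lt_mul_of_pos_left (by nlinarith) hwpos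
      linarith) ⟨ht, le_rfl⟩
  have ht0 : 0 < 1 + t := by
    have := hT₀.trans (hT t ht).1
    linarith
  rw [zetaT, ← div_eq_mul_inv, le_div_iff₀ ht0]
  linarith

end Schedules

section Critic

variable {X A : Type*} [Fintype X] [Fintype A] {p : X → A → X → ℝ} {γ : ℝ}

lemma sum_criticKer_mul (g : X → A → ℝ) (v : X × A → ℝ) (ξ : X × A) :
    ∑ ξ', criticKer p g ξ ξ' * v ξ' = ∑ x', p ξ.1 ξ.2 x' * ∑ a', g x' a' * v (x', a') := by
  simp only [criticKer, Fintype.sum_prod_type, Finset.mul_sum, mul_assoc]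

lemma sum_criticKer (hp : ∀ x, IsPolicy (p x)) {g : X → A → ℝ} (hg : IsPolicy g) (ξ : X × A) :
    ∑ ξ', criticKer p g ξ ξ' = 1 := by
  have := sum_criticKer_mul (p := p) g (fun _ => 1) ξ
  simpa [hg.2, (hp _).2] using this

lemma exists_pow_le_stationary [Nonempty X] [Nonempty A] [DecidableEq X] [DecidableEq A]
    (hp0 : ∀ x a x', 0 ≤ p x a x') {pista : (X → A → ℝ) → X × A → ℝ}
    (hpi : ∀ (η : ℝ) (θ : X → A → ℝ), 0 ≤ η → η < 1 →
      IsStationaryDist (criticKer p (explorePol η θ)) (pista (explorePol η θ)))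
    (herg : ∃ n, 0 < n ∧
      ∀ ξ ξ' : X × A, 0 < kpow (criticKer p (explorePol 0 0)) n ξ ξ') :
    ∃ (c : ℝ) (n : ℕ), 0 < c ∧ ∀ (η : ℝ) (θ : X → A → ℝ), 0 ≤ η → η < 1 → ∀ ξ,
      c * η ^ n ≤ pista (explorePol η θ) ξ := by
  obtain ⟨n, -, hn⟩ := herg
  obtain ⟨ξm, hm⟩ := Finite.exists_min
    fun ξ : (X × A) × (X × A) => kpow (criticKer p (explorePol 0 0)) n ξ.1 ξ.2
  refine ⟨_, n, hn ξm.1 ξm.2, fun η θ h0 h1 ξ => ?_⟩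
  have hunif : ∀ x a, explorePol (0 : ℝ) (0 : X → A → ℝ) x a = 1 / (Fintype.card A : ℝ) := by
    intro x a
    simp [explorePol, softmaxPol]
  have hK : ∀ i j, η * criticKer p (explorePol 0 0) i j ≤ criticKer p (explorePol η θ) i j := by
    intro i j
    simp only [criticKer]
    rw [hunif, mul_left_comm]
    refine mul_le_mul_of_nonneg_left ?_ (hp0 _ _ _)
    have h2 := mul_nonneg (sub_nonneg.2 h1.le) (softmaxPol_pos θ j.1 j.2).le
    rw [mul_one_div, explorePol]
    linarith
  have hK0 : ∀ i j, 0 ≤ criticKer p (explorePol 0 0) i j := by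
    intro i j
    simp only [criticKer]
    rw [hunif]
    have := hp0 i.1 i.2 j.1
    positivity
  have hst := hpi η θ h0 h1
  rw [← hst.sum_mul_kpow n ξ]
  calc kpow (criticKer p (explorePol 0 0)) n ξm.1 ξm.2 * η ^ n
      = ∑ i, pista (explorePol η θ) i *
          (η ^ n * kpow (criticKer p (explorePol 0 0)) n ξm.1 ξm.2) := by
        rw [← Finset.sum_mul, hst.2.1, one_mul, mul_comm]
    _ ≤ ∑ i, pista (explorePol η θ) i * kpow (criticKer p (explorePol η θ)) n i ξ := by
        refine Finset.sum_le_sum fun i _ => mul_le_mul_of_nonneg_left ?_ (hst.1 i)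
        exact (mul_le_mul_of_nonneg_left (hm (i, ξ)) (pow_nonneg h0 n)).trans
          (pow_mul_kpow_le_kpow h0 hK0 hK n i ξ).2

lemma critic_tracking [Nonempty X] [Nonempty A] [DecidableEq X] [DecidableEq A]
    (hp : ∀ x, IsPolicy (p x)) (hγ0 : 0 ≤ γ) (hγ1 : γ < 1) {α c H B : ℝ} (hα : 0 < α)
    (hc : 0 < c) (hH : 0 ≤ H) (hB : 0 ≤ B) {n : ℕ} {r : X → A → ℝ}
    {Q g q : ℝ → X → A → ℝ} {d : ℝ → X × A → ℝ}
    (hg : ∀ t, IsPolicy (g t))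
    (hq : ∀ t x a, q t x a = r x a + γ * ∑ x', p x a x' * ∑ a', g t x' a' * q t x' a')
    (hqB : ∀ t x a, |q t x a| ≤ B)
    (hd : ∀ t, 0 < t → IsStationaryDist (criticKer p (g t)) (d t))
    (hdlow : ∀ t, 0 < t → ∀ ξ, c * etaT t ^ n ≤ d t ξ)
    (hQ : ∀ t, 0 < t → ∀ x a, HasDerivAt (fun s => Q s x a)
      (α * d t (x, a) *
        (r x a + γ * (∑ x', p x a x' * ∑ a', g t x' a' * Q t x' a') - Q t x a)) t)
    (hg' : ∀ t, 0 < t → ∀ R, (∀ x a, |Q t x a| ≤ R) → ∃ g' : X → A → ℝ,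
      (∀ x a, HasDerivAt (fun s => g s x a) (g' x a) t) ∧
        ∀ x a, |g' x a| ≤ H * zetaT t * (1 + R)) :
    ∃ M T : ℝ, 1 ≤ T ∧ ∀ t, T ≤ t → ∀ x a, (Q t x a - q t x a) ^ 2 ≤ M * zetaT t := by
  set Y : ℝ → ℝ := fun t => ∑ ξ : X × A, (Q t ξ.1 ξ.2 - q t ξ.1 ξ.2) ^ 2 with hYdef
  have hYle : ∀ t x a, (Q t x a - q t x a) ^ 2 ≤ Y t := fun t x a =>
    Finset.single_le_sum (f := fun ξ : X × A => (Q t ξ.1 ξ.2 - q t ξ.1 ξ.2) ^ 2)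
      (fun _ _ => sq_nonneg _) (Finset.mem_univ (x, a))
  have hY0 : ∀ t, 0 ≤ Y t := fun t => Finset.sum_nonneg fun _ _ => sq_nonneg _
  have habs : ∀ t x a, |Q t x a - q t x a| ≤ Real.sqrt (Y t) := fun t x a =>
    Real.abs_le_sqrt (hYle t x a)
  set N : ℝ := (Fintype.card (X × A) : ℝ)
  set C₁ : ℝ := Fintype.card A * (H * B) / (1 - γ) with hC₁
  have hγ' : 0 < 1 - γ := by linarith
  have hC₁0 : 0 ≤ C₁ := by positivity
  have hder : ∀ t, 0 < t → ∃ y', HasDerivAt Y y' t ∧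
      y' ≤ -(2 * α * (1 - γ) * c * etaT t ^ n) * Y t
        + (2 * N * C₁ * (1 + B)) * zetaT t * (Real.sqrt (Y t) + Y t) := by
    intro t ht
    set y := Real.sqrt (Y t) with hy
    have hy0 : 0 ≤ y := Real.sqrt_nonneg _
    have hyy : y * y = Y t := Real.mul_self_sqrt (hY0 t)
    have hz := zetaT_pos ht.le
    have hR : ∀ x a, |Q t x a| ≤ y + B := by
      intro x a
      have h1 := habs t x a
      have h2 := hqB t x a
      have h3 := abs_add_le (Q t x a - q t x a) (q t x a)
      rw [sub_add_cancel] at h3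
      linarith
    obtain ⟨g', hg1, hg2⟩ := hg' t ht _ hR
    obtain ⟨q', hq1, hq2⟩ := hasDerivAt_actionValue hp hγ0 hγ1 hg hq hg1
    have hq3 := abs_deriv_actionValue_le hp hγ0 hγ1 (hg t) (hqB t) hg2 (by positivity) hq2
    have hq4 : ∀ x a, |q' x a| ≤ C₁ * zetaT t * (1 + (y + B)) := by
      intro x a
      refine (hq3 x a).trans (le_of_eq ?_)
      rw [hC₁]
      ring
    refine ⟨_, HasDerivAt.fun_sum fun ξ _ =>
      ((hQ t ht ξ.1 ξ.2).fun_sub (hq1 ξ.1 ξ.2)).fun_pow 2, ?_⟩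
    simp only [Nat.cast_ofNat, Nat.add_one_sub_one, pow_one]
    set D : X × A → ℝ := fun ξ => Q t ξ.1 ξ.2 - q t ξ.1 ξ.2 with hD
    have hK0 : ∀ i j, 0 ≤ criticKer p (g t) i j := fun i j =>
      mul_nonneg ((hp _).1 _ _) ((hg t).1 _ _)
    have h1 := (hd t ht).sum_mul_le hK0 (sum_criticKer hp (hg t)) hγ0 D
    have h2 : ∀ ξ : X × A, r ξ.1 ξ.2
        + γ * (∑ x', p ξ.1 ξ.2 x' * ∑ a', g t x' a' * Q t x' a') - Q t ξ.1 ξ.2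
        = γ * (∑ ξ', criticKer p (g t) ξ ξ' * D ξ') - D ξ := by
      intro ξ
      rw [sum_criticKer_mul]
      simp only [hD, mul_sub, Finset.sum_sub_distrib]
      have := hq t ξ.1 ξ.2
      linarith
    have h3 : ∑ ξ : X × A, 2 * D ξ * (α * d t ξ * (γ * (∑ ξ', criticKer p (g t) ξ ξ' * D ξ')
        - D ξ) - q' ξ.1 ξ.2)
        = 2 * α * ∑ ξ, D ξ * (d t ξ * (γ * (∑ ξ', criticKer p (g t) ξ ξ' * D ξ') - D ξ))
          + ∑ ξ, -(2 * D ξ * q' ξ.1 ξ.2) := by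
      rw [Finset.mul_sum, ← Finset.sum_add_distrib]
      exact Finset.sum_congr rfl fun ξ _ => by ring
    have h4 : c * etaT t ^ n * Y t ≤ ∑ ξ, d t ξ * D ξ ^ 2 := by
      rw [hYdef, Finset.mul_sum]
      exact Finset.sum_le_sum fun ξ _ => mul_le_mul_of_nonneg_right (hdlow t ht ξ) (sq_nonneg _)
    have h5 : ∑ ξ : X × A, -(2 * D ξ * q' ξ.1 ξ.2)
        ≤ N * (2 * (y * (C₁ * zetaT t * (1 + (y + B))))) := by
      have e1 := Finset.sum_le_card_nsmul Finset.univ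
        (fun ξ : X × A => -(2 * D ξ * q' ξ.1 ξ.2))
        (2 * (y * (C₁ * zetaT t * (1 + (y + B))))) fun ξ _ => by
          have e2 := mul_le_mul (habs t ξ.1 ξ.2) (hq4 ξ.1 ξ.2) (abs_nonneg _) hy0
          rw [← abs_mul] at e2
          have e3 := (abs_le.1 e2).1
          simp only [hD]
          linarith
      rwa [nsmul_eq_mul, Finset.card_univ] at e1
    calc _ = ∑ ξ : X × A, 2 * D ξ * (α * d t ξ *
          (γ * (∑ ξ', criticKer p (g t) ξ ξ' * D ξ') - D ξ) - q' ξ.1 ξ.2) :=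
          Finset.sum_congr rfl fun ξ _ => by rw [h2 ξ]
      _ ≤ 2 * α * (-(1 - γ) * (c * etaT t ^ n * Y t))
          + N * (2 * (y * (C₁ * zetaT t * (1 + (y + B))))) := by
          rw [h3]
          refine add_le_add (mul_le_mul_of_nonneg_left (h1.trans ?_) (by positivity)) h5
          exact mul_le_mul_of_nonpos_left h4 (by linarith)
      _ ≤ _ := by
          have e1 : y * (1 + (y + B)) ≤ (1 + B) * (y + Y t) := by
            rw [← hyy]
            nlinarith [mul_nonneg hB (mul_nonneg hy0 hy0)]
          have e2 : 0 ≤ 2 * N * C₁ * zetaT t := by positivity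
          have e3 := mul_le_mul_of_nonneg_left e1 e2
          linarith
  choose! Y' hY' hY'le using hder
  obtain ⟨M, T, hT, h⟩ := le_mul_zetaT_of_deriv_le (Y := Y) (Y' := Y')
    (c := 2 * α * (1 - γ) * c) (C := 2 * N * C₁ * (1 + B)) (T₀ := 1) (n := n) (by positivity)
    zero_le_one (fun t _ => hY0 t) (fun t ht => hY' t (by linarith))
    (fun t ht => hY'le t (by linarith))
  exact ⟨M, T, hT, fun t ht x a => (hYle t x a).trans (h t ht)⟩

end Critic

section Actor

lemma exists_occupancy {X A : Type*} [Fintype X] [Fintype A] {γ : ℝ} {p : X → A → X → ℝ}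
    {μ : X → ℝ} {f : X → A → ℝ} {d : X × A → ℝ} (hγ0 : 0 ≤ γ)
    (hp0 : ∀ x a x', 0 ≤ p x a x') (hf : IsPolicy f)
    (hd : IsStationaryDist (actorKer γ p μ f) d) :
    ∃ ν : X → ℝ, (∀ x, (1 - γ) * μ x ≤ ν x ∧ ν x ≤ 1) ∧ ∀ x a, d (x, a) = ν x * f x a := by
  have hν : ∀ x a, d (x, a) = (∑ ξ, d ξ * ptilde γ p μ ξ.1 ξ.2 x) * f x a := by
    intro x a
    rw [hd.2.2 (x, a), Finset.sum_mul]
    exact Finset.sum_congr rfl fun ξ _ => by simp only [actorKer]; ring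
  refine ⟨_, fun x => ⟨?_, ?_⟩, hν⟩
  · calc (1 - γ) * μ x = ∑ ξ, d ξ * ((1 - γ) * μ x) := by
          rw [← Finset.sum_mul, hd.2.1, one_mul]
      _ ≤ _ := by
          refine Finset.sum_le_sum fun ξ _ => mul_le_mul_of_nonneg_left ?_ (hd.1 ξ)
          have := mul_nonneg hγ0 (hp0 ξ.1 ξ.2 x)
          simp only [ptilde]
          linarith
  · calc ∑ ξ, d ξ * ptilde γ p μ ξ.1 ξ.2 x = ∑ a, d (x, a) := by
          simp only [hν x]
          rw [← Finset.mul_sum, hf.2, mul_one]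
      _ ≤ ∑ x, ∑ a, d (x, a) := Finset.single_le_sum (f := fun x => ∑ a, d (x, a))
          (fun y _ => Finset.sum_nonneg fun a _ => hd.1 (y, a)) (Finset.mem_univ x)
      _ = 1 := by rw [← Fintype.sum_prod_type, hd.2.1]

lemma neg_le_softmax_ascent {A : Type*} [Fintype A] {f Q q : A → ℝ} {k z e : ℝ}
    (hf0 : ∀ a, 0 ≤ f a) (hf1 : ∑ a, f a = 1) (hk0 : 0 ≤ k) (hkz : k ≤ z)
    (hQq : ∀ a, |Q a - q a| ≤ e) :
    -(Fintype.card A * (z * e ^ 2)) ≤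
      ∑ a, f a * (k * f a * (Q a - ∑ b, f b * Q b)
        - ∑ b, f b * (k * f b * (Q b - ∑ c, f c * Q c))) * q a := by
  set W := ∑ b, f b * Q b with hW
  set v := ∑ b, f b * q b with hv
  have hWv : |W - v| ≤ e := by
    have h1 : W - v = ∑ b, f b * (Q b - q b) := by
      simp only [hW, hv, mul_sub, Finset.sum_sub_distrib]
    rw [h1]
    exact IsPolicy.abs_sum_mul_le (X := Unit) (f := fun _ => f)
      ⟨fun _ => hf0, fun _ => hf1⟩ () hQq
  have heq : ∑ a, f a * (k * f a * (Q a - W) - ∑ b, f b * (k * f b * (Q b - W))) * q a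
      = ∑ a, f a * (k * f a * (Q a - W)) * (q a - v) := by
    have h1 : ∑ a, f a * (k * f a * (Q a - W) - ∑ b, f b * (k * f b * (Q b - W))) * q a
        = ∑ a, f a * (k * f a * (Q a - W)) * q a
          - v * ∑ b, f b * (k * f b * (Q b - W)) := by
      rw [hv, Finset.sum_mul, ← Finset.sum_sub_distrib]
      exact Finset.sum_congr rfl fun a _ => by ring
    rw [h1, Finset.mul_sum, ← Finset.sum_sub_distrib]
    exact Finset.sum_congr rfl fun a _ => by ring
  rw [heq]
  have hf_le : ∀ a, f a ≤ 1 := fun a => by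
    rw [← hf1]
    exact Finset.single_le_sum (fun b _ => hf0 b) (Finset.mem_univ a)
  have h2 := Finset.card_nsmul_le_sum Finset.univ
    (fun a => f a * (k * f a * (Q a - W)) * (q a - v)) (-(z * e ^ 2)) fun a _ => by
      have e1 := abs_le.1 (hQq a)
      have e2 := abs_le.1 hWv
      have e3 : -(e ^ 2) ≤ (Q a - W) * (q a - v) := by
        have e4 : ((Q a - W) - (q a - v)) ^ 2 ≤ (2 * e) ^ 2 :=
          sq_le_sq' (by linarith [e1.1, e2.2]) (by linarith [e1.2, e2.1])
        nlinarith [sq_nonneg ((Q a - W) + (q a - v))]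
      have e5 : 0 ≤ k * f a ^ 2 := by positivity
      have e6 : k * f a ^ 2 ≤ z := by
        have : f a ^ 2 ≤ 1 := pow_le_one₀ (hf0 a) (hf_le a)
        nlinarith
      have e7 := mul_le_mul_of_nonneg_left e3 e5
      have e8 := mul_le_mul_of_nonneg_right e6 (sq_nonneg e)
      calc -(z * e ^ 2) ≤ k * f a ^ 2 * -(e ^ 2) := by linarith
        _ ≤ k * f a ^ 2 * ((Q a - W) * (q a - v)) := e7
        _ = _ := by ring
  rw [nsmul_eq_mul, Finset.card_univ] at h2
  linarith

lemma exists_deriv_explorePol_le {X A : Type*} [Fintype A] [Nonempty A]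
    {θ : ℝ → X → A → ℝ} {θ' : X → A → ℝ} {t R : ℝ} (ht : 0 < t)
    (hθ : ∀ x a, HasDerivAt (fun s => θ s x a) (θ' x a) t)
    (hθ' : ∀ x a, |θ' x a| ≤ zetaT t * (2 * R)) :
    ∃ g' : X → A → ℝ,
      (∀ x a, HasDerivAt (fun s => explorePol (etaT s) (θ s) x a) (g' x a) t) ∧
        ∀ x a, |g' x a| ≤ 4 * zetaT t * (1 + R) := by
  obtain ⟨η', hη, hη'⟩ := hasDerivAt_etaT ht.le
  have hz := zetaT_pos ht.le
  refine ⟨_, fun x a => (hη.div_const _).fun_add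
    ((hη.const_sub 1).fun_mul (hasDerivAt_softmaxPol hθ x a)), fun x a => ?_⟩
  set f := softmaxPol (θ t) with hf
  have hfpol : IsPolicy f := isPolicy_softmaxPol _
  have hN : (1 : ℝ) ≤ Fintype.card A := by
    exact_mod_cast Nat.one_le_iff_ne_zero.2 Fintype.card_ne_zero
  have h1 : |(1 : ℝ) / Fintype.card A - f x a| ≤ 1 := by
    have e1 : (1 : ℝ) / Fintype.card A ≤ 1 := by rw [div_le_one (by linarith)]; exact hN
    have e2 : (0 : ℝ) ≤ 1 / Fintype.card A := by positivity
    exact abs_le.2 ⟨by linarith [hfpol.le_one x a], by linarith [hfpol.1 x a]⟩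
  have h2 : |η' * ((1 : ℝ) / Fintype.card A - f x a)| ≤ zetaT t := by
    rw [abs_mul]
    exact (mul_le_of_le_one_right (abs_nonneg _) h1).trans hη'
  have h3 : |θ' x a - ∑ b, f x b * θ' x b| ≤ zetaT t * (4 * R) := by
    have e1 := hfpol.abs_sum_mul_le x (hθ' x)
    have e2 := abs_sub (θ' x a) (∑ b, f x b * θ' x b)
    have e3 := hθ' x a
    linarith
  have h4 : |(1 - etaT t) * (f x a * (θ' x a - ∑ b, f x b * θ' x b))| ≤ zetaT t * (4 * R) := by
    rw [← mul_assoc, abs_mul]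
    refine (mul_le_of_le_one_left (abs_nonneg _) ?_).trans h3
    have e1 := etaT_pos t
    have e2 := etaT_le_one t
    rw [abs_of_nonneg (mul_nonneg (by linarith) (hfpol.1 x a))]
    exact mul_le_one₀ (by linarith) (hfpol.1 x a) (hfpol.le_one x a)
  have h5 := abs_add_le (η' * ((1 : ℝ) / Fintype.card A - f x a))
    ((1 - etaT t) * (f x a * (θ' x a - ∑ b, f x b * θ' x b)))
  have h6 : η' / Fintype.card A + (-η' * f x a
      + (1 - etaT t) * (f x a * (θ' x a - ∑ b, f x b * θ' x b)))
      = η' * ((1 : ℝ) / Fintype.card A - f x a)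
        + (1 - etaT t) * (f x a * (θ' x a - ∑ b, f x b * θ' x b)) := by ring
  rw [h6]
  nlinarith

lemma hasDerivAt_arctan_log {t : ℝ} (ht : 0 ≤ t) :
    HasDerivAt (fun s : ℝ => Real.arctan (Real.log (s + 1))) (zetaT t * etaT t) t := by
  refine (hasDerivAt_log_one_add ht).arctan.congr_deriv ?_
  rw [etaT, one_div, mul_comm]

lemma tendsto_of_monotoneOn_bddAbove {W : ℝ → ℝ} {T b : ℝ} (h : MonotoneOn W (Ici T))
    (hb : ∀ t, T ≤ t → W t ≤ b) : ∃ l, Tendsto W atTop (nhds l) := by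
  have hm : Monotone fun t => W (max t T) := fun s t hst =>
    h (mem_Ici.2 (le_max_right _ _)) (mem_Ici.2 (le_max_right _ _)) (max_le_max_right _ hst)
  refine ⟨_, (tendsto_atTop_ciSup hm ⟨b, ?_⟩).congr' ?_⟩
  · rintro _ ⟨t, rfl⟩
    exact hb _ (le_max_right _ _)
  · filter_upwards [eventually_ge_atTop T] with t ht
    rw [max_eq_left ht]

end Actor

theorem global_convergence_limit_flow
    {X A : Type*} [Fintype X] [Fintype A] [Nonempty X] [Nonempty A]
    [DecidableEq X] [DecidableEq A]
    (p : X → A → X → ℝ) (μ : X → ℝ) (r : X → A → ℝ) (γ α : ℝ)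
    (hp0 : ∀ x a x', 0 ≤ p x a x') (hp1 : ∀ x a, ∑ x', p x a x' = 1)
    (hμ0 : ∀ x, 0 ≤ μ x) (hμ1 : ∑ x, μ x = 1)
    (hr : ∀ x a, 0 ≤ r x a ∧ r x a ≤ 1) (hγ : 0 < γ ∧ γ < 1) (hα : 0 < α)
    (hμpos : ∀ x, 0 < μ x)
    (sigsta : (X → A → ℝ) → X × A → ℝ)
    (hsig : ∀ θ : X → A → ℝ,
      IsStationaryDist (actorKer γ p μ (softmaxPol θ)) (sigsta (softmaxPol θ)))
    (hsigLip : ∃ L : ℝ, ∀ f f' : X → A → ℝ,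
      ∑ ξ : X × A, |sigsta f ξ - sigsta f' ξ| ≤ L * ∑ x, ∑ a, |f x a - f' x a|)
    (hergA : ∀ θ : X → A → ℝ, ∃ n, 0 < n ∧
      ∀ ξ ξ' : X × A, 0 < kpow (actorKer γ p μ (softmaxPol θ)) n ξ ξ')
    (pista : (X → A → ℝ) → X × A → ℝ)
    (hpi : ∀ (η : ℝ) (θ : X → A → ℝ), 0 ≤ η → η < 1 →
      IsStationaryDist (criticKer p (explorePol η θ)) (pista (explorePol η θ)))
    (hpiLip : ∃ L : ℝ, ∀ f f' : X → A → ℝ,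
      ∑ ξ : X × A, |pista f ξ - pista f' ξ| ≤ L * ∑ x, ∑ a, |f x a - f' x a|)
    (hergC : ∀ (η : ℝ) (θ : X → A → ℝ), 0 ≤ η → η < 1 → ∃ n, 0 < n ∧
      ∀ ξ ξ' : X × A, 0 < kpow (criticKer p (explorePol η θ)) n ξ ξ')
    (Qb θb : ℝ → X → A → ℝ)
    (hQode : ∀ t, 0 ≤ t → ∀ x a, HasDerivAt (fun s => Qb s x a)
      (α * pista (explorePol (etaT t) (θb t)) (x, a) *
        (r x a + γ * (∑ z, ∑ a'', Qb t z a'' * explorePol (etaT t) (θb t) z a'' * p x a z)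
          - Qb t x a)) t)
    (hθode : ∀ t, 0 ≤ t → ∀ x a, HasDerivAt (fun s => θb s x a)
      (zetaT t * sigsta (softmaxPol (θb t)) (x, a) *
        (Qb t x a - ∑ a', Qb t x a' * softmaxPol (θb t) x a')) t)
    (Vq : (X → A → ℝ) → X → A → ℝ)
    (hVq : ∀ f : X → A → ℝ, IsPolicy f → ∀ x a,
      Vq f x a = r x a + γ * ∑ x', p x a x' * ∑ a', f x' a' * Vq f x' a')
    (J : (X → A → ℝ) → ℝ)
    (hJ : ∀ f : X → A → ℝ, IsPolicy f → J f = ∑ x, μ x * ∑ a, f x a * Vq f x a)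
    (fstar : X → A → ℝ) (hfstarPol : IsPolicy fstar)
    (hfstarOpt : ∀ f : X → A → ℝ, IsPolicy f → J f ≤ J fstar)
    :
    Tendsto (fun t => J fstar - J (softmaxPol (θb t))) atTop (nhds 0) := by
  have hp : ∀ x, IsPolicy (p x) := fun x => ⟨hp0 x, hp1 x⟩
  obtain ⟨hγ0, hγ1⟩ := hγ
  have hγ' : 0 < 1 - γ := by linarith
  have hf : ∀ t, IsPolicy (softmaxPol (θb t)) := fun t => isPolicy_softmaxPol _
  have hg : ∀ t, IsPolicy (explorePol (etaT t) (θb t)) := fun t =>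
    isPolicy_explorePol (etaT_pos t).le (etaT_le_one t) _
  obtain ⟨B, hBdef⟩ : ∃ B : ℝ, B = 1 / (1 - γ) := ⟨_, rfl⟩
  have hB0 : 0 ≤ B := by rw [hBdef]; positivity
  have hB : ∀ f, IsPolicy f → ∀ x a, |Vq f x a| ≤ B := fun f hf x a => by
    rw [hBdef]
    exact abs_le_of_action_bellman hp hf hγ0.le hγ1
      (fun x a => abs_le.2 ⟨by linarith [(hr x a).1], (hr x a).2⟩) (hVq f hf) x a
  choose ν hν hσ using fun t => exists_occupancy hγ0.le hp0 (hf t) (hsig (θb t))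
  have hθ : ∀ t, 0 ≤ t → ∀ x a, HasDerivAt (fun s => θb s x a)
      (zetaT t * ν t x * softmaxPol (θb t) x a *
        (Qb t x a - ∑ b, softmaxPol (θb t) x b * Qb t x b)) t := by
    intro t ht x a
    refine (hθode t ht x a).congr_deriv ?_
    rw [hσ, ← mul_assoc]
    simp only [mul_comm (Qb t x _)]
  have hν0 : ∀ t x, 0 < ν t x := fun t x => lt_of_lt_of_le (mul_pos hγ' (hμpos x)) (hν t x).1
  -- the critic tracks the action values of the exploration policy
  obtain ⟨c, n, hc, hlow⟩ := exists_pow_le_stationary hp0 hpi (hergC 0 0 le_rfl one_pos)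
  obtain ⟨M, T₁, hT₁, htrack⟩ := critic_tracking hp hγ0.le hγ1 hα hc (H := 4) (B := B)
    (by norm_num) hB0 (n := n) (r := r) (Q := Qb) (g := fun t => explorePol (etaT t) (θb t))
    (q := fun t => Vq (explorePol (etaT t) (θb t)))
    (d := fun t => pista (explorePol (etaT t) (θb t))) hg
    (fun t => hVq _ (hg t)) (fun t => hB _ (hg t))
    (fun t ht => hpi _ _ (etaT_pos t).le (etaT_lt_one ht))
    (fun t ht => hlow _ _ (etaT_pos t).le (etaT_lt_one ht))
    (fun t ht x a => by
      refine (hQode t ht.le x a).congr_deriv ?_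
      congr 4
      refine Finset.sum_congr rfl fun z _ => ?_
      rw [Finset.mul_sum]
      exact Finset.sum_congr rfl fun a' _ => by ring)
    (fun t ht R hR => by
      refine exists_deriv_explorePol_le ht (hθ t ht.le) fun x a => ?_
      have e1 : |Qb t x a - ∑ b, softmaxPol (θb t) x b * Qb t x b| ≤ 2 * R := by
        have e2 := (hf t).abs_sum_mul_le x (hR x)
        have e3 := abs_sub (Qb t x a) (∑ b, softmaxPol (θb t) x b * Qb t x b)
        have e4 := hR x a
        linarith
      have hz := zetaT_pos ht.le
      rw [mul_assoc, mul_assoc, abs_mul, abs_of_pos hz]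
      refine mul_le_mul_of_nonneg_left ?_ hz.le
      rw [← mul_assoc, abs_mul]
      refine (mul_le_of_le_one_left (abs_nonneg _) ?_).trans e1
      rw [abs_of_nonneg (mul_nonneg (hν0 t x).le ((hf t).1 x a))]
      exact mul_le_one₀ (hν t x).2 ((hf t).1 x a) ((hf t).le_one x a))
  -- and hence those of the softmax policy, up to an error of order `√η`
  obtain ⟨C, hC⟩ : ∃ C : ℝ, C = 2 * |M| + 2 * (Fintype.card A * B / (1 - γ)) ^ 2 := ⟨_, rfl⟩
  have hC0 : 0 ≤ C := by rw [hC]; positivity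
  obtain ⟨T₂, hT₂⟩ := eventually_atTop.1 (eventually_mul_zetaT_le_etaT_pow 1 1)
  obtain ⟨T, hT⟩ : ∃ T, T = max T₁ T₂ := ⟨_, rfl⟩
  have hTT : ∀ t, T ≤ t → 1 ≤ t ∧ T₁ ≤ t ∧ T₂ ≤ t := fun t ht => by
    rw [hT] at ht
    have h1 := (le_max_left T₁ T₂).trans ht
    exact ⟨hT₁.trans h1, h1, (le_max_right _ _).trans ht⟩
  have herr : ∀ t, T ≤ t → ∀ x a,
      |Qb t x a - Vq (softmaxPol (θb t)) x a| ≤ Real.sqrt (C * etaT t) := by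
    intro t ht x a
    obtain ⟨h1t, ht1, ht2⟩ := hTT t ht
    have h1 := htrack t ht1 x a
    have hη0 := etaT_pos t
    have hη1 := etaT_le_one t
    have h2 := hT₂ t ht2
    rw [one_mul, pow_one] at h2
    have h3 := abs_actionValue_sub_le hp hγ0.le hγ1 (hg t) (hVq _ (hf t)) (hVq _ (hg t))
      (hB _ (hf t)) hη0.le (fun x a => by
        have hN : (1 : ℝ) ≤ Fintype.card A := by
          exact_mod_cast Nat.one_le_iff_ne_zero.2 Fintype.card_ne_zero
        have e1 : (1 : ℝ) / Fintype.card A ≤ 1 := by rw [div_le_one (by linarith)]; exact hN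
        have e2 : (0 : ℝ) ≤ 1 / Fintype.card A := by positivity
        have e3 : explorePol (etaT t) (θb t) x a - softmaxPol (θb t) x a
            = etaT t * (1 / Fintype.card A - softmaxPol (θb t) x a) := by
          rw [explorePol]
          ring
        rw [e3, abs_mul, abs_of_pos hη0]
        refine mul_le_of_le_one_right hη0.le (abs_le.2 ⟨?_, ?_⟩)
        · linarith [(hf t).le_one x a]
        · linarith [(hf t).1 x a]) x a
    refine Real.abs_le_sqrt ?_
    have h4 : (Vq (explorePol (etaT t) (θb t)) x a - Vq (softmaxPol (θb t)) x a) ^ 2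
        ≤ (Fintype.card A * B / (1 - γ)) ^ 2 * etaT t := by
      rw [← sq_abs]
      calc _ ≤ (Fintype.card A * (etaT t * B) / (1 - γ)) ^ 2 :=
            pow_le_pow_left₀ (abs_nonneg _) h3 2
        _ = (Fintype.card A * B / (1 - γ)) ^ 2 * (etaT t * etaT t) := by ring
        _ ≤ _ := mul_le_mul_of_nonneg_left (mul_le_of_le_one_left hη0.le hη1) (sq_nonneg _)
    have h5 : M * zetaT t ≤ |M| * etaT t :=
      mul_le_mul (le_abs_self M) h2 (zetaT_pos (by linarith)).le (abs_nonneg _)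
    rw [hC]
    nlinarith [sq_nonneg ((Qb t x a - Vq (explorePol (etaT t) (θb t)) x a)
      - (Vq (explorePol (etaT t) (θb t)) x a - Vq (softmaxPol (θb t)) x a))]
  have hηlim : Tendsto etaT atTop (nhds 0) := by
    have h2 : Tendsto (fun t : ℝ => Real.log (t + 1)) atTop atTop :=
      Real.tendsto_log_atTop.comp (tendsto_atTop_add_const_right _ _ tendsto_id)
    exact ((tendsto_atTop_add_const_left _ 1
      ((tendsto_pow_atTop two_ne_zero).comp h2))).inv_tendsto_atTop
  have herrlim : ∀ x a,
      Tendsto (fun t => Qb t x a - Vq (softmaxPol (θb t)) x a) atTop (nhds 0) := by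
    intro x a
    have h1 : Tendsto (fun t => Real.sqrt (C * etaT t)) atTop (nhds 0) := by
      have := (hηlim.const_mul C).sqrt
      simpa using this
    refine squeeze_zero_norm' ?_ h1
    filter_upwards [eventually_ge_atTop T] with t ht using herr t ht x a
  -- the state values converge, being increasing up to an integrable error
  set V : ℝ → X → ℝ := fun t x =>
    ∑ a, softmaxPol (θb t) x a * Vq (softmaxPol (θb t)) x a with hVdef
  have hVle : ∀ t x, |V t x| ≤ B := fun t x => (hf t).abs_sum_mul_le x (hB _ (hf t) x)
  obtain ⟨E, hE⟩ : ∃ E : ℝ, E = Fintype.card A * C / (1 - γ) := ⟨_, rfl⟩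
  have hVder : ∀ t, T ≤ t → ∀ x, ∃ v', HasDerivAt (fun s => V s x) v' t ∧
      -(E * (zetaT t * etaT t)) ≤ v' := by
    intro t ht x
    have ht0 : 0 ≤ t := by linarith [(hTT t ht).1]
    have hf' := hasDerivAt_softmaxPol (hθ t ht0)
    obtain ⟨q', hq1, hq2⟩ := hasDerivAt_actionValue hp hγ0.le hγ1 hf
      (fun s => hVq _ (hf s)) hf'
    refine ⟨_, HasDerivAt.fun_sum fun a _ => (hf' x a).fun_mul (hq1 x a), ?_⟩
    have h1 := neg_le_deriv_stateValue hp hγ0.le hγ1 (hf t)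
      (u := Fintype.card A * (zetaT t * Real.sqrt (C * etaT t) ^ 2)) (fun y =>
        neg_le_softmax_ascent ((hf t).1 y) ((hf t).2 y)
          (mul_nonneg (zetaT_pos ht0).le (hν0 t y).le)
          (mul_le_of_le_one_right (zetaT_pos ht0).le (hν t y).2) (herr t ht y)) hq2 x
    refine le_trans (le_of_eq ?_) h1
    rw [Real.sq_sqrt (mul_nonneg hC0 (etaT_pos t).le), hE]
    ring
  have hE0 : 0 ≤ E := by rw [hE]; positivity
  have hVconv : ∀ x, ∃ l, Tendsto (fun t => V t x) atTop (nhds l) := by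
    intro x
    choose! v' hv1 hv2 using fun t ht => hVder t ht x
    have hWder : ∀ t, T ≤ t → HasDerivAt
        (fun s => V s x + E * Real.arctan (Real.log (s + 1)))
        (v' t + E * (zetaT t * etaT t)) t := fun t ht =>
      (hv1 t ht).fun_add ((hasDerivAt_arctan_log (by linarith [(hTT t ht).1])).const_mul E)
    have hmono : MonotoneOn (fun s => V s x + E * Real.arctan (Real.log (s + 1))) (Ici T) := by
      refine monotoneOn_of_hasDerivWithinAt_nonneg (convex_Ici T)
        (fun t ht => (hWder t ht).continuousAt.continuousWithinAt)
        (fun t ht => (hWder t (interior_subset ht)).hasDerivWithinAt) fun t ht => ?_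
      linarith [hv2 t (interior_subset ht)]
    obtain ⟨l, hl⟩ := tendsto_of_monotoneOn_bddAbove hmono (b := B + E * (Real.pi / 2))
      fun t _ => add_le_add (abs_le.1 (hVle t x)).2
        (mul_le_mul_of_nonneg_left (Real.arctan_lt_pi_div_two _).le hE0)
    have hlog : Tendsto (fun t : ℝ => Real.log (t + 1)) atTop atTop :=
      Real.tendsto_log_atTop.comp (tendsto_atTop_add_const_right _ _ tendsto_id)
    have harc : Tendsto (fun t : ℝ => Real.arctan (Real.log (t + 1))) atTop
        (nhds (Real.pi / 2)) :=
      (tendsto_nhds_of_tendsto_nhdsWithin Real.tendsto_arctan_atTop).comp hlog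
    refine ⟨_, (hl.sub (harc.const_mul E)).congr fun t => ?_⟩
    ring
  choose Vlim hVlim using hVconv
  have hQlim : ∀ x a, Tendsto (fun t => Qb t x a) atTop
      (nhds (r x a + γ * ∑ x', p x a x' * Vlim x')) := by
    intro x a
    have h1 : Tendsto (fun t => Vq (softmaxPol (θb t)) x a) atTop
        (nhds (r x a + γ * ∑ x', p x a x' * Vlim x')) := by
      refine Tendsto.congr (fun t => (hVq _ (hf t) x a).symm) ?_
      exact ((tendsto_finsetSum _ fun x' _ => (hVlim x').const_mul _).const_mul _).const_add _
    have := (herrlim x a).add h1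
    simpa using this
  have hWlim : ∀ x, Tendsto (fun t => ∑ a, softmaxPol (θb t) x a * Qb t x a) atTop
      (nhds (Vlim x)) := by
    intro x
    have h1 : Tendsto (fun t => ∑ a, softmaxPol (θb t) x a *
        (Qb t x a - Vq (softmaxPol (θb t)) x a)) atTop (nhds 0) := by
      have h2 : Tendsto (fun t => ∑ a, |Qb t x a - Vq (softmaxPol (θb t)) x a|) atTop
          (nhds 0) := by
        have := tendsto_finsetSum Finset.univ fun a _ => (herrlim x a).abs
        simpa using this
      refine squeeze_zero_norm (fun t => (Finset.abs_sum_le_sum_abs _ _).trans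
        (Finset.sum_le_sum fun a _ => ?_)) h2
      rw [abs_mul, abs_of_nonneg ((hf t).1 x a)]
      exact mul_le_of_le_one_left (abs_nonneg _) ((hf t).le_one x a)
    have h3 := h1.add (hVlim x)
    rw [zero_add] at h3
    refine h3.congr fun t => ?_
    simp only [hVdef, mul_sub, Finset.sum_sub_distrib]
    ring
  -- the limit satisfies the Bellman optimality inequality
  have hopt : ∀ x a, r x a + γ * ∑ x', p x a x' * Vlim x' ≤ Vlim x := by
    intro x a
    refine limit_le_of_softmax_flow (θ := fun t => θb t x) (f := fun t => softmaxPol (θb t) x)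
      (q := fun t => Qb t x) (k := fun t => zetaT t * ν t x) (c := (1 - γ) * μ x)
      (qlim := fun a => r x a + γ * ∑ x', p x a x' * Vlim x') le_rfl
      (mul_pos hγ' (hμpos x)) (fun t ht => ?_) (fun t a => rfl) (fun t ht a => hθ t ht x a)
      (hQlim x) (hWlim x) a
    rw [mul_comm]
    exact mul_le_mul_of_nonneg_left (hν t x).1 (zetaT_pos ht).le
  have hstar : ∀ x, ∑ a, fstar x a * Vq fstar x a ≤ Vlim x := by
    intro x
    have h1 := le_of_state_bellman_le hp hfstarPol hγ0.le hγ1 (u := 0)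
      (D := fun x => ∑ a, fstar x a * Vq fstar x a - Vlim x) (fun y => ?_) x
    · rw [zero_div] at h1
      linarith
    · have e1 : ∑ a, fstar y a * Vq fstar y a - ∑ a, fstar y a *
          (r y a + γ * ∑ x', p y a x' * Vlim x')
          = γ * ∑ a, fstar y a * ∑ x', p y a x' *
            (∑ a', fstar x' a' * Vq fstar x' a' - Vlim x') := by
        rw [← Finset.sum_sub_distrib, Finset.mul_sum]
        refine Finset.sum_congr rfl fun a _ => ?_
        rw [hVq fstar hfstarPol y a]
        simp only [mul_sub, Finset.sum_sub_distrib]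
        ring
      have e2 := hfstarPol.sum_mul_le y (hopt y)
      linarith
  have hJlim : Tendsto (fun t => J fstar - J (softmaxPol (θb t))) atTop
      (nhds (J fstar - ∑ x, μ x * Vlim x)) := by
    refine Tendsto.const_sub _ (Tendsto.congr (fun t => (hJ _ (hf t)).symm) ?_)
    exact tendsto_finsetSum _ fun x _ => (hVlim x).const_mul _
  have hle : J fstar - ∑ x, μ x * Vlim x ≤ 0 := by
    rw [hJ fstar hfstarPol, sub_nonpos]
    exact Finset.sum_le_sum fun x _ => mul_le_mul_of_nonneg_left (hstar x) (hμ0 x)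
  have hge : 0 ≤ J fstar - ∑ x, μ x * Vlim x :=
    ge_of_tendsto' hJlim fun t => sub_nonneg.2 (hfstarOpt _ (hf t))
  rwa [le_antisymm hle hge] at hJlim
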